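/- Fix an integer m ≥ 1 and set R = m. For every ε > 0 there exists Q such that for every finite field F with |F| > Q and characteristic p > 3, every subgroup H of the symplectic group Sp_{2m}(F), and every normal subgroup N of H such that H/N is abelian of order coprime to p and |H/N| > 1, one has log [Sp_{2m}(F) : H] ≥ (R − ε) · log |H/N|. -/

import Mathlib

namespace SpIdx
open MeasureTheory Module

theorem packing {E : Type*} [NormedAddCommGroup E] [NormedSpace ℝ E] [FiniteDimensional ℝ E]
    (D : ℕ) (hD : 0 < D) (s : Finset E) (hs : ∀ c ∈ s, ‖c‖ ≤ 1)
    (h : ∀ c ∈ s, ∀ d ∈ s, c ≠ d → 1 / (D : ℝ) ≤ ‖c - d‖) :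
    s.card ≤ (2 * D + 1) ^ finrank ℝ E := by
  borelize E
  let μ : Measure E := Measure.addHaar
  have hD' : (0 : ℝ) < D := by exact_mod_cast hD
  obtain ⟨δ, hδ⟩ : ∃ δ : ℝ, δ = 1 / (2 * D) := ⟨_, rfl⟩
  have δpos : 0 < δ := by rw [hδ]; positivity
  obtain ⟨ρ, hρ⟩ : ∃ ρ : ℝ, ρ = (2 * D + 1) * δ := ⟨_, rfl⟩
  have ρpos : 0 < ρ := by rw [hρ]; positivity
  have hρ2 : ρ = δ + 1 := by rw [hρ, hδ]; field_simp; ring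
  have hδ2 : δ + δ = 1 / D := by rw [hδ]; field_simp; norm_num
  set A := ⋃ c ∈ s, Metric.ball (c : E) δ with hA
  have Dj : Set.Pairwise (s : Set E) (Function.onFun Disjoint fun c => Metric.ball (c : E) δ) := by
    rintro c hc d hd hcd
    apply Metric.ball_disjoint_ball
    rw [dist_eq_norm, hδ2]
    exact h c hc d hd hcd
  have A_subset : A ⊆ Metric.ball (0 : E) ρ := by
    refine Set.iUnion₂_subset fun x hx => ?_
    apply Metric.ball_subset_ball'
    rw [dist_zero_right, hρ2]
    exact add_le_add le_rfl (hs x hx)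
  have I :
    (s.card : ENNReal) * ENNReal.ofReal (δ ^ finrank ℝ E) * μ (Metric.ball 0 1) ≤
      ENNReal.ofReal (ρ ^ finrank ℝ E) * μ (Metric.ball 0 1) :=
    calc
      (s.card : ENNReal) * ENNReal.ofReal (δ ^ finrank ℝ E) * μ (Metric.ball 0 1) = μ A := by
        rw [hA, measure_biUnion_finset Dj fun c _ => measurableSet_ball]
        simp only [μ.addHaar_ball_of_pos _ δpos]
        simp only [Finset.sum_const, nsmul_eq_mul, mul_assoc]
      _ ≤ μ (Metric.ball (0 : E) ρ) := measure_mono A_subset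
      _ = ENNReal.ofReal (ρ ^ finrank ℝ E) * μ (Metric.ball 0 1) := by
        simp only [μ.addHaar_ball_of_pos _ ρpos]
  have J : (s.card : ENNReal) * ENNReal.ofReal (δ ^ finrank ℝ E) ≤
      ENNReal.ofReal (ρ ^ finrank ℝ E) :=
    (ENNReal.mul_le_mul_iff_left (Metric.measure_ball_pos _ _ zero_lt_one).ne'
      measure_ball_lt_top.ne).1 I
  have K : (s.card : ℝ) * δ ^ finrank ℝ E ≤ ρ ^ finrank ℝ E := by
    have := ENNReal.toReal_le_of_le_ofReal (pow_nonneg ρpos.le _) J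
    rw [ENNReal.toReal_mul, ENNReal.toReal_ofReal (by positivity)] at this
    simpa using this
  rw [hρ, mul_pow] at K
  have K2 := le_of_mul_le_mul_right K (by positivity)
  exact_mod_cast K2

/-- a scalar `c` near `1` with `c ^ k = 1` is `1` -/
theorem root_near_one (k : ℕ) (hk : 0 < k) (c : ℂ) (hc : c ^ k = 1)
    (h : ‖c - 1‖ < 1 / ((k : ℝ) + 2)) : c = 1 := by
  by_contra hne
  have hn : ‖c‖ = 1 := Complex.norm_eq_one_of_pow_eq_one hc hk.ne'
  have hs : ∑ i ∈ Finset.range k, c ^ i = 0 := by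
    have := mul_geom_sum c k
    rw [hc, sub_self] at this
    rcases mul_eq_zero.1 this with h0 | h0
    · exact absurd (sub_eq_zero.1 h0) hne
    · exact h0
  have hpow : ∀ i : ℕ, ‖c ^ i - 1‖ ≤ i * ‖c - 1‖ := by
    intro i
    induction i with
    | zero => simp
    | succ i ih =>
      have : c ^ (i+1) - 1 = c * (c ^ i - 1) + (c - 1) := by ring
      rw [this]
      refine (norm_add_le _ _).trans ?_
      rw [norm_mul, hn]
      push_cast
      linarith
  have h1 : ‖∑ i ∈ Finset.range k, (c ^ i - 1)‖ ≤ ∑ i ∈ Finset.range k, (k : ℝ) * ‖c - 1‖ := by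
    refine (norm_sum_le _ _).trans (Finset.sum_le_sum ?_)
    intro i hi
    refine (hpow i).trans ?_
    have : (i : ℝ) ≤ k := by exact_mod_cast (Finset.mem_range.1 hi).le
    gcongr
  rw [Finset.sum_sub_distrib, hs] at h1
  simp at h1
  have hk' : (0:ℝ) < k := by exact_mod_cast hk
  have h2 : (1:ℝ) ≤ k * ‖c - 1‖ := by
    have : (k:ℝ) * 1 ≤ k * (k * ‖c-1‖) := by simpa using h1
    exact le_of_mul_le_mul_left this hk'
  have h3 : (k:ℝ) * ‖c - 1‖ < k * (1 / (k+2)) := by gcongr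
  have h4 : (k:ℝ) * (1 / (k+2)) < 1 := by
    rw [mul_one_div, div_lt_one (by positivity)]; linarith
  linarith
end SpIdx


namespace SpIdx
open Module

theorem jordan_step {K V : Type} [Group K] [Finite K] [NormedAddCommGroup V] [NormedSpace ℂ V]
    [FiniteDimensional ℂ V] (ρ : K →* (V →ₗ[ℂ] V)) (inv : ∀ g v, ‖ρ g v‖ = ‖v‖) (k : ℕ)
    (hk : 0 < k) (hV : finrank ℂ V = k) :
    ∃ K1 : Subgroup K, K1.index ≤ (2 * (k + 2) + 1) ^ (2 * (k * k)) ∧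
      ((∀ a ∈ K1, ∀ b ∈ K1, ρ a * ρ b = ρ b * ρ a) ∨
        ∃ g, (∀ c : ℂ, ρ g ≠ c • 1) ∧ ∀ h ∈ K1, ρ g * ρ h = ρ h * ρ g) := by
  classical
  have : Nontrivial V := Module.nontrivial_of_finrank_pos (R := ℂ) (by omega)
  obtain ⟨C, hC⟩ : ∃ C : K → (V →L[ℂ] V), ∀ g v, C g v = ρ g v :=
    ⟨fun g => LinearMap.toContinuousLinearMap (ρ g), fun g v => rfl⟩
  have Cmul : ∀ g h, C (g * h) = C g * C h := by
    intro g h; ext v; simp [hC]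
  have Cone : C 1 = 1 := by ext v; simp [hC]
  have Cnorm : ∀ g, ‖C g‖ ≤ 1 := by
    intro g
    refine ContinuousLinearMap.opNorm_le_bound _ zero_le_one fun v => ?_
    rw [hC, inv, one_mul]
  have Cl : ∀ g (T : V →L[ℂ] V), ‖C g * T‖ ≤ ‖T‖ := fun g T => by
    refine (norm_mul_le _ _).trans ?_
    nlinarith [Cnorm g, norm_nonneg T]
  have Cr : ∀ g (T : V →L[ℂ] V), ‖T * C g‖ ≤ ‖T‖ := fun g T => by
    refine (norm_mul_le _ _).trans ?_
    nlinarith [Cnorm g, norm_nonneg T]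
  have Cinj : ∀ g h, C g = C h → ρ g = ρ h := by
    intro g h e
    ext v; rw [← hC, ← hC, e]
  set δ : ℝ := 1 / ((k + 2 : ℕ) : ℝ) with hδ
  have δ2 : 2 * δ ≤ 1 := by
    rw [hδ, mul_one_div, div_le_one (by positivity)]; push_cast; linarith
  have δpos : 0 < δ := by positivity
  let K1 : Subgroup K := Subgroup.closure {g | ‖C g - 1‖ < δ}
  refine ⟨K1, ?_, ?_⟩
  · -- packing
    have : Fintype (K ⧸ K1) := Fintype.ofFinite _
    let f : K ⧸ K1 → (V →L[ℂ] V) := fun x => C x.out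
    have sep : ∀ x y, x ≠ y → δ ≤ ‖f x - f y‖ := by
      intro x y hxy
      by_contra hlt
      push Not at hlt
      apply hxy
      have : y.out⁻¹ * x.out ∈ K1 := by
        apply Subgroup.subset_closure
        change ‖C _ - 1‖ < δ
        have e : C (y.out⁻¹ * x.out) - 1 = C (y.out⁻¹) * (f x - f y) := by
          simp only [f, mul_sub, ← Cmul, inv_mul_cancel, Cone]
        rw [e]
        exact (Cl _ _).trans_lt hlt
      have h2 := QuotientGroup.eq.2 this
      rw [QuotientGroup.out_eq', QuotientGroup.out_eq'] at h2
      exact h2.symm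
    have finj : Function.Injective f := by
      intro x y hxy
      by_contra hne
      have := sep x y hne
      rw [hxy, sub_self, norm_zero] at this
      linarith
    let _i : NormedSpace ℝ (V →L[ℂ] V) := NormedSpace.complexToReal
    have : FiniteDimensional ℂ (V →L[ℂ] V) := inferInstance
    have : FiniteDimensional ℝ (V →L[ℂ] V) := FiniteDimensional.complexToReal _
    have hp := packing (E := V →L[ℂ] V) (k+2) (by omega) (Finset.univ.image f)
      (by intro c hc; obtain ⟨x, -, rfl⟩ := Finset.mem_image.1 hc; exact Cnorm _)
      (by
        intro c hc d hd hcd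
        obtain ⟨x, -, rfl⟩ := Finset.mem_image.1 hc
        obtain ⟨y, -, rfl⟩ := Finset.mem_image.1 hd
        exact sep x y (fun e => hcd (by rw [e])))
    rw [Finset.card_image_of_injective _ finj, Finset.card_univ] at hp
    rw [Subgroup.index, Nat.card_eq_fintype_card]
    refine hp.trans (le_of_eq ?_)
    congr 1
    rw [finrank_real_of_complex]
    congr 1
    rw [← (LinearMap.toContinuousLinearMap (𝕜 := ℂ) (E := V) (F' := V)).finrank_eq,
      Module.finrank_linearMap, hV]
  · by_cases hsc : ∀ g, ‖C g - 1‖ < δ → ∃ c : ℂ, ρ g = c • 1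
    · left
      have key : ∀ a ∈ K1, ∃ c : ℂ, ρ a = c • 1 := by
        intro a ha
        induction ha using Subgroup.closure_induction with
        | mem x hx => exact hsc x hx
        | one => exact ⟨1, by simp⟩
        | mul x y _ _ hx hy =>
          obtain ⟨c, hc⟩ := hx
          obtain ⟨d, hd⟩ := hy
          exact ⟨c * d, by rw [map_mul, hc, hd, smul_mul_smul_comm, one_mul]⟩
        | inv x _ hx =>
          obtain ⟨c, hc⟩ := hx
          have h1 : ρ x⁻¹ * ρ x = 1 := by rw [← map_mul]; simp
          rw [hc] at h1
          have hc0 : c ≠ 0 := by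
            rintro rfl
            simp at h1
          refine ⟨c⁻¹, ?_⟩
          rw [mul_smul_comm, mul_one] at h1
          rw [← h1, smul_smul, inv_mul_cancel₀ hc0, one_smul]
      intro a ha b hb
      obtain ⟨c, hc⟩ := key a ha
      rw [hc]
      simp
    · right
      push Not at hsc
      let S : Set K := {g | ‖C g - 1‖ < δ ∧ ∀ c : ℂ, ρ g ≠ c • 1}
      have hSne : S.Nonempty := hsc
      obtain ⟨g, hgS, hgmin⟩ := Set.exists_min_image S (fun g => ‖C g - 1‖) (Set.toFinite S) hSne
      refine ⟨g, hgS.2, ?_⟩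
      have small : ∀ h, ‖C h - 1‖ < δ → ρ g * ρ h = ρ h * ρ g := by
        intro h hh
        have e1 : C (g * h * g⁻¹ * h⁻¹) - 1
            = ((C g - 1) * (C h - 1) - (C h - 1) * (C g - 1)) * C (g⁻¹ * h⁻¹) := by
          have : (C g - 1) * (C h - 1) - (C h - 1) * (C g - 1) = C (g * h) - C (h * g) := by
            rw [Cmul, Cmul]; noncomm_ring
          rw [this, sub_mul, ← Cmul, ← Cmul]
          congr 1
          · congr 1; group
          · rw [← Cone]; congr 1; group
        have hgpos : 0 < ‖C g - 1‖ := by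
          rw [norm_pos_iff]
          intro h0
          apply hgS.2 1
          have : C g = C 1 := by rw [Cone]; exact sub_eq_zero.1 h0
          rw [Cinj _ _ this]; simp
        have e2 : ‖C (g * h * g⁻¹ * h⁻¹) - 1‖ < ‖C g - 1‖ := by
          rw [e1]
          refine (Cr _ _).trans_lt ((norm_sub_le _ _).trans_lt ?_)
          have a1 := norm_mul_le (C g - 1) (C h - 1)
          have a2 := norm_mul_le (C h - 1) (C g - 1)
          nlinarith
        have e3 : ∃ c : ℂ, ρ (g * h * g⁻¹ * h⁻¹) = c • 1 := by
          by_contra hns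
          push Not at hns
          have := hgmin (g * h * g⁻¹ * h⁻¹) ⟨e2.trans hgS.1, hns⟩
          linarith
        obtain ⟨c, hc⟩ := e3
        have hdet : c ^ k = 1 := by
          have h1 : LinearMap.det (ρ (g * h * g⁻¹ * h⁻¹)) = 1 := by
            let φ : K →* ℂ := (LinearMap.det (M := V) (A := ℂ)).comp ρ
            change φ _ = 1
            have u : ∀ x, φ x * φ x⁻¹ = 1 := fun x => by rw [← map_mul]; simp
            rw [map_mul, map_mul, map_mul]
            linear_combination (φ h * φ h⁻¹) * u g + u h
          rw [hc, LinearMap.det_smul, hV] at h1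
          simpa using h1
        have hcn : ‖c - 1‖ < 1 / ((k:ℝ) + 2) := by
          have e4 : C (g * h * g⁻¹ * h⁻¹) - 1 = (c - 1) • (1 : V →L[ℂ] V) := by
            ext v
            simp only [sub_apply, hC, hc]
            simp [sub_smul]
          have e5 : ‖c - 1‖ < ‖C g - 1‖ := by
            rw [e4, norm_smul] at e2
            simpa using e2
          have := e5.trans hgS.1
          rw [hδ] at this
          push_cast at this
          exact this
        have hc1 := root_near_one k hk c hdet hcn
        rw [hc1, one_smul] at hc
        have e6 : ρ (g * h) = ρ (g * h * g⁻¹ * h⁻¹) * ρ (h * g) := by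
          rw [← map_mul]; congr 1; group
        rw [← map_mul, e6, hc, one_mul, map_mul]
      intro h hh
      induction hh using Subgroup.closure_induction with
      | mem x hx => exact small x hx
      | one => simp
      | mul x y _ _ hx hy =>
        rw [map_mul, ← mul_assoc, hx, mul_assoc, hy, mul_assoc]
      | inv x _ hx =>
        have h1 : ρ x⁻¹ * ρ x = 1 := by rw [← map_mul]; simp
        have h2 : ρ x * ρ x⁻¹ = 1 := by rw [← map_mul]; simp
        calc ρ g * ρ x⁻¹ = ρ x⁻¹ * (ρ x * ρ g) * ρ x⁻¹ := by
              rw [← mul_assoc, h1, one_mul]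
          _ = ρ x⁻¹ * ρ g := by rw [← hx, mul_assoc, mul_assoc, h2, mul_one]
end SpIdx


namespace SpIdx
open Module

theorem jordan_step' {K V : Type} [Group K] [Finite K] [AddCommGroup V] [Module ℂ V]
    [FiniteDimensional ℂ V] (ρ : K →* (V →ₗ[ℂ] V)) (k : ℕ)
    (hk : 0 < k) (hV : finrank ℂ V = k) :
    ∃ K1 : Subgroup K, K1.index ≤ (2 * (k + 2) + 1) ^ (2 * (k * k)) ∧
      ((∀ a ∈ K1, ∀ b ∈ K1, ρ a * ρ b = ρ b * ρ a) ∨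
        ∃ g, (∀ c : ℂ, ρ g ≠ c • 1) ∧ ∀ h ∈ K1, ρ g * ρ h = ρ h * ρ g) := by
  have : Fintype K := Fintype.ofFinite K
  let b := finBasis ℂ V
  let f : V →ₗ[ℂ] (K → Fin (finrank ℂ V) → ℂ) :=
    LinearMap.pi fun g => b.equivFun.toLinearMap ∘ₗ ρ g
  have hf : ∀ v g, f v g = b.equivFun (ρ g v) := fun v g => rfl
  have finj : Function.Injective f := by
    intro v w h
    have h1 : f v 1 = f w 1 := by rw [h]
    rw [hf, hf] at h1
    simpa using h1
  let _n : NormedAddCommGroup V := NormedAddCommGroup.induced V _ f finj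
  let _s : NormedSpace ℂ V := NormedSpace.induced ℂ V _ f
  refine jordan_step ρ ?_ k hk hV
  have hle : ∀ g v, ‖ρ g v‖ ≤ ‖v‖ := by
    intro g v
    change ‖f (ρ g v)‖ ≤ ‖f v‖
    rw [pi_norm_le_iff_of_nonneg (norm_nonneg _)]
    intro h
    have : f (ρ g v) h = f v (h * g) := by rw [hf, hf, map_mul]; rfl
    rw [this]
    exact norm_le_pi_norm _ _
  intro g v
  refine le_antisymm (hle g v) ?_
  have := hle g⁻¹ (ρ g v)
  rwa [← Module.End.mul_apply, ← map_mul, inv_mul_cancel, map_one, Module.End.one_apply] at this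

/-- restriction of a representation to an invariant subspace -/
def subrep {K V : Type} [Group K] [AddCommGroup V] [Module ℂ V]
    (ρ : K →* (V →ₗ[ℂ] V)) (K1 : Subgroup K) (W : Submodule ℂ V)
    (hW : ∀ h ∈ K1, ∀ w ∈ W, ρ h w ∈ W) : K1 →* (W →ₗ[ℂ] W) where
  toFun h := (ρ h).restrict (hW h h.2)
  map_one' := by ext; simp
  map_mul' x y := by ext; simp

theorem jordan (k : ℕ) : ∃ J : ℕ, ∀ (K V : Type) [Group K] [Finite K] [AddCommGroup V]
    [Module ℂ V] [FiniteDimensional ℂ V] (ρ : K →* (V →ₗ[ℂ] V)), finrank ℂ V ≤ k →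
    ∃ Z : Subgroup K, Z.index ≤ J ∧ ∀ a ∈ Z, ∀ b ∈ Z, ρ a * ρ b = ρ b * ρ a := by
  induction k with
  | zero =>
    refine ⟨1, fun K V _ _ _ _ _ ρ h => ⟨⊤, by simp, fun a _ b _ => ?_⟩⟩
    have : Subsingleton V := finrank_zero_iff.1 (Nat.le_zero.1 h)
    ext v
    exact Subsingleton.elim _ _
  | succ k ih =>
    obtain ⟨J, hJ⟩ := ih
    obtain ⟨B, hB⟩ : ∃ B, B = (2 * (k + 1 + 2) + 1) ^ (2 * ((k + 1) * (k + 1))) := ⟨_, rfl⟩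
    refine ⟨J + B + J * J * B, fun K V _ _ _ _ _ ρ h => ?_⟩
    rcases Nat.lt_or_ge k (finrank ℂ V) with hlt | hge
    swap
    · obtain ⟨Z, h1, h2⟩ := hJ K V ρ hge
      exact ⟨Z, by omega, h2⟩
    have hV : finrank ℂ V = k + 1 := by omega
    have : Nontrivial V := Module.nontrivial_of_finrank_pos (R := ℂ) (by omega)
    obtain ⟨K1, hK1, hc | ⟨g, hg, hcomm⟩⟩ := jordan_step' ρ (k+1) (by omega) hV
    · exact ⟨K1, by rw [← hB] at hK1; omega, hc⟩
    · rw [← hB] at hK1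
      obtain ⟨lam, hlam⟩ := Module.End.exists_eigenvalue (ρ g)
      let f : V →ₗ[ℂ] V := ρ g - lam • 1
      let W := LinearMap.ker f
      let W' := LinearMap.range f
      have fcomm : ∀ h ∈ K1, ∀ v, f (ρ h v) = ρ h (f v) := by
        intro h hh v
        have := LinearMap.congr_fun (hcomm h hh) v
        simp only [Module.End.mul_apply] at this
        simp [f, this]
      have hWne : W ≠ ⊥ := by
        obtain ⟨v, hv⟩ := hlam.exists_hasEigenvector
        intro h0
        apply hv.2
        have : v ∈ W := by
          have := hv.apply_eq_smul
          simp [W, f, this]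
        rw [h0] at this
        simpa using this
      have hWtop : W ≠ ⊤ := by
        intro h0
        apply hg lam
        ext v
        have : v ∈ W := by rw [h0]; trivial
        have : f v = 0 := this
        simp only [f, LinearMap.sub_apply, sub_eq_zero] at this
        exact this
      have hinf : W ⊓ W' = ⊥ := by
        rw [eq_bot_iff]
        rintro w ⟨hw, v, rfl⟩
        have hw' : f (f v) = 0 := hw
        obtain ⟨w, hwd⟩ : ∃ w, w = f v := ⟨_, rfl⟩
        rw [← hwd] at hw' ⊢
        have e1 : ρ g w = lam • w := by
          simpa [f, sub_eq_zero] using hw'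
        have e2 : ρ g v = lam • v + w := by rw [hwd]; simp [f]
        have e3 : ∀ n : ℕ, (ρ g ^ n) w = lam ^ n • w := by
          intro n
          induction n with
          | zero => simp
          | succ n ih => rw [pow_succ, Module.End.mul_apply, e1, map_smul, ih, smul_smul, pow_succ']
        have e4 : ∀ n : ℕ, lam • (ρ g ^ n) v = lam ^ (n+1) • v + ((n:ℂ) * lam ^ n) • w := by
          intro n
          induction n with
          | zero => simp
          | succ n ih =>
            rw [pow_succ, Module.End.mul_apply, e2, map_add, map_smul, e3, smul_add, ih]
            push_cast
            module
        have hN : (ρ g) ^ (orderOf g) = 1 := by rw [← map_pow, pow_orderOf_eq_one, map_one]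
        have hNpos : 0 < orderOf g := orderOf_pos g
        by_contra hw0
        have hw0 : w ≠ 0 := by simpa using hw0
        have l1 : lam ^ orderOf g = 1 := by
          have := e3 (orderOf g)
          rw [hN, Module.End.one_apply] at this
          have h2 : (lam ^ orderOf g - 1) • w = 0 := by rw [sub_smul, ← this, one_smul, sub_self]
          rcases smul_eq_zero.1 h2 with h3 | h3
          · exact sub_eq_zero.1 h3
          · exact absurd h3 hw0
        have := e4 (orderOf g)
        rw [hN, Module.End.one_apply, pow_succ, l1, one_mul, mul_one] at this
        have h2 : ((orderOf g : ℕ) : ℂ) • w = 0 := by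
          have h3 := this.symm
          rwa [add_eq_left] at h3
        rcases smul_eq_zero.1 h2 with h3 | h3
        · norm_cast at h3; omega
        · exact hw0 h3
      have hdim := f.finrank_range_add_finrank_ker
      have hWlt : finrank ℂ W ≤ k := by
        have := Submodule.finrank_lt hWtop
        omega
      have hWpos : 0 < finrank ℂ W := by
        rw [Nat.pos_iff_ne_zero]; intro h0; exact hWne (Submodule.finrank_eq_zero.1 h0)
      have hW'lt : finrank ℂ W' ≤ k := by
        change finrank ℂ W' + finrank ℂ W = _ at hdim
        omega
      have hsup : W ⊔ W' = ⊤ := by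
        apply Submodule.eq_top_of_finrank_eq
        have := Submodule.finrank_sup_add_finrank_inf_eq W W'
        rw [hinf, finrank_bot] at this
        change finrank ℂ W' + finrank ℂ W = _ at hdim
        omega
      have invW : ∀ h ∈ K1, ∀ w ∈ W, ρ h w ∈ W := by
        intro h hh w hw
        change f _ = 0
        rw [fcomm h hh, show f w = 0 from hw, map_zero]
      have invW' : ∀ h ∈ K1, ∀ w ∈ W', ρ h w ∈ W' := by
        rintro h hh _ ⟨v, rfl⟩
        exact ⟨ρ h v, fcomm h hh v⟩
      obtain ⟨Z1, i1, c1⟩ := hJ K1 W (subrep ρ K1 W invW) hWlt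
      obtain ⟨Z2, i2, c2⟩ := hJ K1 W' (subrep ρ K1 W' invW') hW'lt
      refine ⟨(Z1 ⊓ Z2).map K1.subtype, ?_, ?_⟩
      · rw [Subgroup.index_map_subtype]
        have := (Z1.index_inf_le (K := Z2))
        have h3 : Z1.index * Z2.index ≤ J * J := Nat.mul_le_mul i1 i2
        have h4 : (Z1 ⊓ Z2).index * K1.index ≤ J * J * B := Nat.mul_le_mul (this.trans h3) hK1
        omega
      · rintro _ ⟨a, ha, rfl⟩ _ ⟨b, hb, rfl⟩
        ext v
        have hv : v ∈ W ⊔ W' := by rw [hsup]; trivial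
        obtain ⟨x, hx, y, hy, rfl⟩ := Submodule.mem_sup.1 hv
        have q1 := congrArg Subtype.val (LinearMap.congr_fun (c1 a ha.1 b hb.1) ⟨x, hx⟩)
        have q2 := congrArg Subtype.val (LinearMap.congr_fun (c2 a ha.2 b hb.2) ⟨y, hy⟩)
        change ρ a (ρ b x) = ρ b (ρ a x) at q1
        change ρ a (ρ b y) = ρ b (ρ a y) at q2
        simp only [Subgroup.subtype_apply, Module.End.mul_apply, map_add, q1, q2]
end SpIdx

namespace SpIdx

theorem nat_dvd_mul_left {S : Type*} [Ring S] (n : ℕ) (x y : S) (h : (n : S) ∣ y) :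
    (n : S) ∣ x * y := by
  obtain ⟨c, rfl⟩ := h
  exact ⟨x * c, by rw [← mul_assoc, ← mul_assoc, Nat.cast_comm]⟩

theorem nat_dvd_mul_mul {S : Type*} [Ring S] (a b : ℕ) (x y : S) (h : (a : S) ∣ x)
    (h' : (b : S) ∣ y) : ((a * b : ℕ) : S) ∣ x * y := by
  obtain ⟨c, rfl⟩ := h
  obtain ⟨d, rfl⟩ := h'
  refine ⟨c * d, ?_⟩
  push_cast
  rw [mul_assoc, ← mul_assoc c, ← Nat.cast_comm b c]
  simp only [mul_assoc]

theorem lift_step {S K : Type*} [Ring S] [Group K] [Fintype K] (p j : ℕ) (hj : 1 ≤ j)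
    (a b : ℤ) (hab : a * Fintype.card K = 1 + p * b) (φ : K → S)
    (h1 : (p : S) ∣ φ 1 - 1)
    (hφ : ∀ g h, ((p ^ j : ℕ) : S) ∣ φ g * φ h - φ (g * h)) :
    ∃ ψ : K → S, (∀ g, ((p ^ j : ℕ) : S) ∣ ψ g - φ g) ∧
      ∀ g h, ((p ^ (j + 1) : ℕ) : S) ∣ ψ g * ψ h - ψ (g * h) := by
  obtain ⟨c, hc⟩ : ∃ c : K → K → S, ∀ g h, c g h = φ g * φ h - φ (g * h) := ⟨_, fun _ _ => rfl⟩
  simp only [← hc] at hφ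
  have hpj : ∀ x : S, ((p ^ j : ℕ) : S) ∣ x → (p : S) ∣ x := by
    intro x hx
    refine dvd_trans ?_ hx
    push_cast
    exact dvd_pow_self _ (by omega)
  have up : ∀ x y : S, ((p ^ j : ℕ) : S) ∣ x → (p : S) ∣ y → ((p ^ (j+1) : ℕ) : S) ∣ x * y := by
    intro x y hx hy
    rw [pow_succ]
    exact nat_dvd_mul_mul _ _ _ _ hx hy
  have up' : ∀ x y : S, ((p ^ j : ℕ) : S) ∣ x → (p : S) ∣ y → ((p ^ (j+1) : ℕ) : S) ∣ y * x := by
    intro x y hx hy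
    rw [pow_succ']
    exact nat_dvd_mul_mul _ _ _ _ hy hx
  let s : K → S := fun g => ∑ l, c g l * φ l⁻¹
  have hs : ∀ g, ((p ^ j : ℕ) : S) ∣ s g := fun g =>
    Finset.dvd_sum fun l _ => Dvd.dvd.mul_right (hφ g l) _
  have cocycle : ∀ g h l, c g h * φ l = φ g * c h l - c (g * h) l + c g (h * l) := by
    intro g h l
    simp only [hc, mul_assoc]
    noncomm_ring
  -- main identity
  have main : ∀ g h, ((p ^ (j + 1) : ℕ) : S) ∣
      (Fintype.card K : S) * c g h - (φ g * s h - s (g * h) + s g * φ h) := by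
    intro g h
    have e1 : (Fintype.card K : S) * c g h = ∑ l : K, c g h := by simp
    have e2 : s g * φ h = ∑ l : K, c g l * φ l⁻¹ * φ h := by simp only [s, Finset.sum_mul]
    have e3 : φ g * s h = ∑ l : K, φ g * (c h l * φ l⁻¹) := by simp only [s, Finset.mul_sum]
    have e4 : ∑ l : K, c g (h * l) * φ l⁻¹ = ∑ l : K, c g l * φ (l⁻¹ * h) := by
      refine Fintype.sum_equiv (Equiv.mulLeft h) _ _ fun l => ?_
      simp
    have e5 : (Fintype.card K : S) * c g h - (φ g * s h - s (g * h) + s g * φ h) =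
        ∑ l : K, (c g h * (1 - φ l * φ l⁻¹)) - ∑ l : K, (c g l * (φ l⁻¹ * φ h - φ (l⁻¹ * h))) := by
      have e6 : ∑ l : K, (c g h * (1 - φ l * φ l⁻¹)) = ∑ l : K, c g h -
          ((∑ l : K, φ g * (c h l * φ l⁻¹)) - ∑ l : K, c (g * h) l * φ l⁻¹
            + ∑ l : K, c g (h * l) * φ l⁻¹) := by
        rw [← Finset.sum_sub_distrib, ← Finset.sum_add_distrib, ← Finset.sum_sub_distrib]
        refine Finset.sum_congr rfl fun l _ => ?_
        have := cocycle g h l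
        rw [mul_sub, mul_one, ← mul_assoc (c g h), this]
        noncomm_ring
      have e7 : ∑ l : K, (c g l * (φ l⁻¹ * φ h - φ (l⁻¹ * h))) =
          ∑ l : K, c g l * φ l⁻¹ * φ h - ∑ l : K, c g l * φ (l⁻¹ * h) := by
        rw [← Finset.sum_sub_distrib]
        refine Finset.sum_congr rfl fun l _ => ?_
        rw [mul_sub, mul_assoc]
      rw [e6, e7, e1, e2, e3, e4]
      simp only [s]
      abel
    rw [e5]
    refine dvd_sub (Finset.dvd_sum fun l _ => up _ _ (hφ g h) ?_)
      (Finset.dvd_sum fun l _ => up _ _ (hφ g l) ?_)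
    · have : 1 - φ l * φ l⁻¹ = -(φ 1 - 1) - c l l⁻¹ := by
        rw [hc, mul_inv_cancel]; abel
      rw [this]
      exact dvd_sub ((dvd_neg).2 h1) (hpj _ (hφ _ _))
    · rw [← hc]; exact hpj _ (hφ _ _)
  have hZ : ∀ (x : S) (n : ℕ), ((n : ℕ) : S) ∣ x → ((n : ℕ) : S) ∣ (a : S) * x :=
    fun x n h => nat_dvd_mul_left _ _ _ h
  refine ⟨fun g => φ g - a * s g, fun g => ?_, fun g h => ?_⟩
  · have : φ g - a * s g - φ g = - (a * s g) := by abel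
    rw [this]
    exact (dvd_neg).2 (hZ _ _ (hs g))
  · have ac : ∀ x : S, x * (a : S) = a * x := fun x => (Int.cast_comm a x).symm
    have key : (φ g - a * s g) * (φ h - a * s h) - (φ (g * h) - a * s (g * h)) =
        (a * ((Fintype.card K : S) * c g h - (φ g * s h - s (g * h) + s g * φ h))
          - (p : S) * (b * c g h)) + (a * s g) * (a * s h) := by
      have hab' : (a : S) * (Fintype.card K : S) = 1 + p * b := by exact_mod_cast congrArg (Int.cast (R := S)) hab
      have : (a : S) * ((Fintype.card K : S) * c g h) = c g h + p * (b * c g h) := by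
        rw [← mul_assoc, hab', add_mul, one_mul, mul_assoc]
      rw [mul_sub (a : S), this, hc]
      have h2 : φ g * (a * s h) = a * (φ g * s h) := by rw [← mul_assoc, ac, mul_assoc]
      simp only [sub_mul, mul_sub, mul_add, h2, mul_assoc]
      abel
    rw [key]
    refine dvd_add (dvd_sub (hZ _ _ (main g h)) ?_) ?_
    · exact up' _ _ (nat_dvd_mul_left _ _ _ (hφ g h)) dvd_rfl
    · exact up _ _ (hZ _ _ (hs g)) (hpj _ (hZ _ _ (hs h)))
end SpIdx

namespace SpIdx
open Module

theorem natCast_dvd_matrix {R ι : Type*} [CommRing R] [Fintype ι] [DecidableEq ι] (n : ℕ)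
    (A : Matrix ι ι R) : (n : Matrix ι ι R) ∣ A ↔ ∀ i j, (n : R) ∣ A i j := by
  have e : ∀ B : Matrix ι ι R, (n : Matrix ι ι R) * B = (n : R) • B := by
    intro B
    rw [← nsmul_eq_mul, Nat.cast_smul_eq_nsmul]
  constructor
  · rintro ⟨B, rfl⟩ i j
    exact ⟨B i j, by rw [e]; rfl⟩
  · intro h
    choose B hB using h
    refine ⟨Matrix.of B, ?_⟩
    rw [e]
    ext i j
    exact hB i j

theorem lift_complete {R K ι : Type*} [CommRing R] [Group K] [Fintype K] [Fintype ι]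
    [DecidableEq ι] (p : ℕ) [IsAdicComplete (Ideal.span {(p : R)}) R]
    (a b : ℤ) (hab : a * Fintype.card K = 1 + p * b) (φ : K → Matrix ι ι R)
    (h1 : (p : Matrix ι ι R) ∣ φ 1 - 1)
    (hφ : ∀ g h, (p : Matrix ι ι R) ∣ φ g * φ h - φ (g * h)) :
    ∃ ψ : K →* Matrix ι ι R, ∀ g, (p : Matrix ι ι R) ∣ ψ g - φ g := by
  classical
  let T : ℕ → Type _ := fun j => {f : K → Matrix ι ι R // (p : Matrix ι ι R) ∣ f 1 - 1 ∧
    ∀ g h, ((p ^ (j+1) : ℕ) : Matrix ι ι R) ∣ f g * f h - f (g * h)}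
  have step : ∀ j (f : T j), ∃ f' : T (j+1), ∀ g,
      ((p ^ (j+1) : ℕ) : Matrix ι ι R) ∣ f'.1 g - f.1 g := by
    intro j f
    obtain ⟨ψ, e1, e2⟩ := lift_step p (j+1) (by omega) a b hab f.1 f.2.1 f.2.2
    refine ⟨⟨ψ, ?_, e2⟩, e1⟩
    have : ψ 1 - 1 = (ψ 1 - f.1 1) + (f.1 1 - 1) := by abel
    rw [this]
    refine dvd_add (dvd_trans ?_ (e1 1)) f.2.1
    push_cast
    exact dvd_pow_self _ (by omega)
  choose nxt hnxt using step
  let seq : ∀ j, T j := fun j => Nat.rec (motive := T) ⟨φ, h1, by simpa using hφ⟩ (fun j f => nxt j f) j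
  have hseq : ∀ j g, ((p ^ (j+1) : ℕ) : Matrix ι ι R) ∣ (seq (j+1)).1 g - (seq j).1 g :=
    fun j g => hnxt j (seq j) g
  have hseq0 : ∀ g, (seq 0).1 g = φ g := fun g => rfl
  have hle : ∀ m n, m ≤ n → ∀ g, ((p ^ (m+1) : ℕ) : Matrix ι ι R) ∣ (seq n).1 g - (seq m).1 g := by
    intro m n hmn g
    induction n, hmn using Nat.le_induction with
    | base => simp
    | succ n hmn ih =>
      have : (seq (n+1)).1 g - (seq m).1 g =
        ((seq (n+1)).1 g - (seq n).1 g) + ((seq n).1 g - (seq m).1 g) := by abel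
      rw [this]
      refine dvd_add (dvd_trans ?_ (hseq n g)) ih
      push_cast
      exact pow_dvd_pow _ (by omega)
  have mem : ∀ (n : ℕ) (x y : R), x ≡ y [SMOD (Ideal.span {(p : R)} ^ n • ⊤ : Submodule R R)] ↔
      ((p ^ n : ℕ) : R) ∣ x - y := by
    intro n x y
    rw [SModEq.sub_mem, smul_eq_mul, Ideal.mul_top, Ideal.span_singleton_pow,
      Ideal.mem_span_singleton]
    push_cast; rfl
  have lim : ∀ g i j, ∃ L : R, ∀ n, ((p ^ n : ℕ) : R) ∣ (seq n).1 g i j - L := by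
    intro g i j
    obtain ⟨L, hL⟩ := IsPrecomplete.prec' (I := Ideal.span {(p : R)})
      (fun n => (seq n).1 g i j) (by
        intro m n hmn
        rw [mem]
        have := (natCast_dvd_matrix _ _).1 (hle m n hmn g) i j
        rw [Matrix.sub_apply] at this
        rw [← dvd_neg, neg_sub]
        refine dvd_trans ?_ this
        push_cast
        exact pow_dvd_pow _ (by omega))
    exact ⟨L, fun n => (mem _ _ _).1 (hL n)⟩
  choose L hL using lim
  let ψ : K → Matrix ι ι R := fun g => Matrix.of (L g)
  have hψ : ∀ n g, ((p ^ n : ℕ) : Matrix ι ι R) ∣ (seq n).1 g - ψ g := by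
    intro n g
    rw [natCast_dvd_matrix]
    intro i j
    exact hL g i j n
  have haus : ∀ A : Matrix ι ι R, (∀ n : ℕ, ((p ^ n : ℕ) : Matrix ι ι R) ∣ A) → A = 0 := by
    intro A hA
    ext i j
    apply IsHausdorff.haus' (I := Ideal.span {(p : R)})
    intro n
    rw [mem]
    simpa using (natCast_dvd_matrix _ _).1 (hA n) i j
  have hpφ : ∀ g, (p : Matrix ι ι R) ∣ ψ g - φ g := by
    intro g
    have e1 := hψ 1 g
    have e2 := hseq 0 g
    have : ψ g - φ g = -((seq 1).1 g - ψ g) + ((seq 1).1 g - (seq 0).1 g) := by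
      rw [hseq0]; abel
    rw [this]
    refine dvd_add ((dvd_neg).2 ?_) ?_
    · simpa using e1
    · simpa using e2
  have hmul : ∀ g h, ψ g * ψ h = ψ (g * h) := by
    intro g h
    rw [← sub_eq_zero]
    apply haus
    intro n
    have : ψ g * ψ h - ψ (g * h) = ((seq n).1 g * (seq n).1 h - (seq n).1 (g * h))
        + ((seq n).1 (g * h) - ψ (g * h)) - ((seq n).1 g - ψ g) * (seq n).1 h
        - ψ g * ((seq n).1 h - ψ h) := by noncomm_ring
    rw [this]
    refine dvd_sub (dvd_sub (dvd_add (dvd_trans ?_ ((seq n).2.2 g h)) (hψ n _)) ?_) ?_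
    · push_cast
      exact pow_dvd_pow _ (by omega)
    · exact Dvd.dvd.mul_right (hψ n _) _
    · exact nat_dvd_mul_left _ _ _ (hψ n _)
  have hone : ψ 1 = 1 := by
    rw [← sub_eq_zero]
    have hid : (1 - ψ 1) * (1 - ψ 1) = 1 - ψ 1 := by
      have := hmul 1 1
      rw [mul_one] at this
      rw [mul_sub, sub_mul, sub_mul, this]; simp
    have hp1 : (p : Matrix ι ι R) ∣ 1 - ψ 1 := by
      have : 1 - ψ 1 = -((ψ 1 - φ 1) + (φ 1 - 1)) := by abel
      rw [this]
      exact (dvd_neg).2 (dvd_add (hpφ 1) h1)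
    have : ∀ n : ℕ, ((p ^ n : ℕ) : Matrix ι ι R) ∣ 1 - ψ 1 := by
      intro n
      induction n with
      | zero => simp
      | succ n ih =>
        rw [← hid, pow_succ]
        exact nat_dvd_mul_mul _ _ _ _ ih hp1
    have h0 := haus _ this
    rw [← neg_sub, h0, neg_zero]
  exact ⟨⟨⟨ψ, hone⟩, fun g h => (hmul g h).symm⟩, hpφ⟩

theorem witt_embed (p : ℕ) [Fact p.Prime] (F : Type) [Field F] [Fintype F] [CharP F p] :
    ∃ f : WittVector p F →+* ℂ, Function.Injective f := by
  have hp : (p : WittVector p F) ≠ 0 := WittVector.p_nonzero p F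
  have : CharZero (WittVector p F) := by
    obtain ⟨ℓ, hℓ⟩ := CharP.exists (WittVector p F)
    rcases CharP.char_is_prime_or_zero (WittVector p F) ℓ with h | h
    · exfalso
      have e1 : ((ℓ : ℕ) : WittVector p F) = 0 := CharP.cast_eq_zero _ _
      have e2 : ((ℓ : ℕ) : F) = 0 := by
        have := congrArg (WittVector.constantCoeff (p := p) (R := F)) e1
        simpa only [map_natCast, map_zero] using this
      rw [CharP.cast_eq_zero_iff F p] at e2
      have e3 := (Nat.prime_dvd_prime_iff_eq (Fact.out) h).1 e2
      rw [← e3] at e1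
      exact hp e1
    · subst h
      exact CharP.charP_to_charZero _
  let A := AlgebraicClosure (FractionRing (WittVector p F))
  have i1 : Function.Injective (algebraMap (WittVector p F) (FractionRing (WittVector p F))) :=
    IsFractionRing.injective _ _
  have : CharZero (FractionRing (WittVector p F)) := charZero_of_injective_algebraMap i1
  have : CharZero A := charZero_of_injective_algebraMap
    (FaithfulSMul.algebraMap_injective (FractionRing (WittVector p F)) A)
  have c1 : Cardinal.mk (WittVector p F) = Cardinal.continuum := by
    have e : WittVector p F ≃ (ℕ → F) := ⟨WittVector.coeff, WittVector.mk p, fun x => rfl, fun x => rfl⟩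
    rw [Cardinal.mk_congr e]
    have h2 : (Cardinal.mk (ℕ → F)) = Cardinal.mk F ^ Cardinal.aleph0 := by
      rw [← Cardinal.mk_nat, Cardinal.power_def]
    rw [h2]
    refine Cardinal.power_aleph0_of_le_continuum ?_ ?_
    · rw [Cardinal.mk_fintype]; exact_mod_cast Fintype.one_lt_card
    · rw [Cardinal.mk_fintype]; exact (Cardinal.nat_lt_continuum _).le
  have : Infinite (WittVector p F) := by
    rw [Cardinal.infinite_iff, c1]; exact Cardinal.aleph0_le_continuum
  have c2 : Cardinal.mk A = Cardinal.continuum := by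
    have h2 := Cardinal.mk_fractionRing (WittVector p F)
    have : Infinite (FractionRing (WittVector p F)) := Infinite.of_injective _ i1
    have h3 := Algebra.IsAlgebraic.cardinalMk_le_max (FractionRing (WittVector p F)) A
    rw [h2, c1, max_eq_left Cardinal.aleph0_le_continuum] at h3
    refine le_antisymm h3 ?_
    have h4 := Cardinal.mk_le_of_injective
      (FaithfulSMul.algebraMap_injective (FractionRing (WittVector p F)) A)
    rwa [h2, c1] at h4
  obtain ⟨e⟩ := IsAlgClosed.ringEquiv_of_equiv_of_charZero (K := A) (L := ℂ)
    (by rw [c2]; exact Cardinal.aleph0_lt_continuum)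
    (Cardinal.eq.1 (by rw [c2, Cardinal.mk_complex]))
  refine ⟨e.toRingHom.comp ((algebraMap (FractionRing (WittVector p F)) A).comp
    (algebraMap (WittVector p F) (FractionRing (WittVector p F)))), ?_⟩
  exact e.injective.comp ((FaithfulSMul.algebraMap_injective (FractionRing (WittVector p F)) A).comp i1)

/-- The Jordan theorem for linear groups of order prime to the characteristic -/
theorem jordan_coprime (k : ℕ) : ∃ J : ℕ, ∀ (F K ι : Type) [Field F] [Fintype F] [Group K] [Finite K]
    [Fintype ι] [DecidableEq ι] (ρ : K →* Matrix ι ι F), Fintype.card ι ≤ k →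
    (Nat.card K).Coprime (ringChar F) →
    ∃ Z : Subgroup K, Z.index ≤ J ∧ ∀ a ∈ Z, ∀ b ∈ Z, ρ a * ρ b = ρ b * ρ a := by
  obtain ⟨J, hJ⟩ := jordan k
  refine ⟨J, fun F K ι _ _ _ _ _ _ ρ hι hK => ?_⟩
  have : Fintype K := Fintype.ofFinite K
  obtain ⟨p, hp⟩ := CharP.exists F
  have hpp : p.Prime := CharP.char_is_prime F p
  have : Fact p.Prime := ⟨hpp⟩
  rw [ringChar.eq F p, Nat.card_eq_fintype_card] at hK
  obtain ⟨f, hf⟩ := witt_embed p F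
  obtain ⟨a, b, hab⟩ : ∃ a b : ℤ, a * Fintype.card K = 1 + p * b := by
    have := Nat.gcd_eq_gcd_ab (Fintype.card K) p
    rw [hK.gcd_eq_one] at this
    refine ⟨Nat.gcdA (Fintype.card K) p, -Nat.gcdB (Fintype.card K) p, ?_⟩
    push_cast at this
    linarith
  have hdvd : ∀ A : Matrix ι ι (WittVector p F), (p : Matrix ι ι (WittVector p F)) ∣ A ↔
      (WittVector.constantCoeff (p := p) (R := F)).mapMatrix A = 0 := by
    intro A
    rw [natCast_dvd_matrix, ← Matrix.ext_iff]
    refine forall_congr' fun i => forall_congr' fun j => ?_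
    rw [← Ideal.mem_span_singleton, ← WittVector.ker_constantCoeff, RingHom.mem_ker]
    rfl
  have hlift : ∀ g, ∃ A : Matrix ι ι (WittVector p F),
      (WittVector.constantCoeff (p := p) (R := F)).mapMatrix A = ρ g := by
    intro g
    have := fun i j => WittVector.constantCoeff_surjective p (ρ g i j)
    choose A hA using this
    exact ⟨Matrix.of A, by ext i j; exact hA i j⟩
  choose φ hφ using hlift
  obtain ⟨ψ, hψ⟩ := lift_complete p a b hab φ
    (by rw [hdvd, map_sub, hφ, map_one, map_one, sub_self])
    (by intro g h; rw [hdvd, map_sub, map_mul, hφ, hφ, hφ, map_mul, sub_self])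
  have hψ' : ∀ g, (WittVector.constantCoeff (p := p) (R := F)).mapMatrix (ψ g) = ρ g := by
    intro g
    have := (hdvd _).1 (hψ g)
    rw [map_sub, hφ] at this
    exact sub_eq_zero.1 this
  let τ : K →* ((ι → ℂ) →ₗ[ℂ] (ι → ℂ)) :=
    ((Matrix.toLinAlgEquiv' (R := ℂ) (n := ι)).toRingEquiv.toMonoidHom).comp
      ((f.mapMatrix (m := ι)).toMonoidHom.comp ψ)
  obtain ⟨Z, h1, h2⟩ := hJ K (ι → ℂ) τ (by simpa using hι)
  refine ⟨Z, h1, fun x hx y hy => ?_⟩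
  have e1 := h2 x hx y hy
  have e2 : f.mapMatrix (ψ x) * f.mapMatrix (ψ y) = f.mapMatrix (ψ y) * f.mapMatrix (ψ x) := by
    apply (Matrix.toLinAlgEquiv' (R := ℂ) (n := ι)).injective
    rw [map_mul, map_mul]
    exact e1
  rw [← map_mul f.mapMatrix, ← map_mul f.mapMatrix] at e2
  have e3 : ψ x * ψ y = ψ y * ψ x := by
    apply Matrix.ext
    intro i j
    exact hf (congrFun (congrFun e2 i) j)
  rw [← hψ', ← hψ', ← map_mul, e3, map_mul]
end SpIdx

namespace SpIdx

section ringE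
variable {E : Type*} [CommRing E]

theorem card_maxspec_le [Finite E] {F : Type*} [Field F] [Fintype F] [Algebra F E] (k : ℕ)
    (hE : Nat.card E ≤ (Fintype.card F) ^ k) : Nat.card (MaximalSpectrum E) ≤ k := by
  have : Finite (MaximalSpectrum E) :=
    Finite.of_injective (fun I => (I.asIdeal : Set E)) (by
      intro I J h
      ext1
      exact SetLike.coe_injective h)
  have : Fintype (MaximalSpectrum E) := Fintype.ofFinite _
  have hs : Function.Surjective (fun (x : E) (I : MaximalSpectrum E) => Ideal.Quotient.mk I.asIdeal x) := by
    have hco : Pairwise (Function.onFun IsCoprime fun I : MaximalSpectrum E => I.asIdeal) := by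
      intro I J hIJ
      exact Ideal.isCoprime_of_isMaximal (fun h => hIJ (by ext1; exact h))
    exact Ideal.pi_mkQ_surjective hco
  have h1 := Nat.card_le_card_of_surjective _ hs
  rw [Nat.card_pi] at h1
  have h2 : ∀ I : MaximalSpectrum E, Fintype.card F ≤ Nat.card (E ⧸ I.asIdeal) := by
    intro I
    have : Nontrivial (E ⧸ I.asIdeal) := Ideal.Quotient.nontrivial_iff.2 I.isMaximal.ne_top
    have : Function.Injective (algebraMap F (E ⧸ I.asIdeal)) := (algebraMap F (E ⧸ I.asIdeal)).injective
    have : Finite (E ⧸ I.asIdeal) := Finite.of_surjective _ (Ideal.Quotient.mk_surjective)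
    rw [← Nat.card_eq_fintype_card]
    exact Nat.card_le_card_of_injective _ ‹Function.Injective (algebraMap F (E ⧸ I.asIdeal))›
  have h3 : (Fintype.card F) ^ (Nat.card (MaximalSpectrum E)) ≤ ∏ I : MaximalSpectrum E, Nat.card (E ⧸ I.asIdeal) := by
    rw [Nat.card_eq_fintype_card]
    calc _ = ∏ I : MaximalSpectrum E, Fintype.card F := by simp
      _ ≤ _ := Finset.prod_le_prod' fun I _ => h2 I
  exact (Nat.pow_le_pow_iff_right (Fintype.one_lt_card)).1 (h3.trans (h1.trans hE))

theorem idem_sep (e f : E) (he : e * e = e) (hf : f * f = f)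
    (h : ∀ I : MaximalSpectrum E, e ∈ I.asIdeal ↔ f ∈ I.asIdeal) : e = f := by
  have hg : ∀ I : MaximalSpectrum E, e - f ∈ I.asIdeal := by
    intro I
    have hI := I.isMaximal
    by_cases h1 : e ∈ I.asIdeal
    · exact I.asIdeal.sub_mem h1 ((h I).1 h1)
    · have h2 : f ∉ I.asIdeal := fun h2 => h1 ((h I).2 h2)
      have e1 : 1 - e ∈ I.asIdeal := by
        have : e * (1 - e) ∈ I.asIdeal := by rw [mul_sub, mul_one, he, sub_self]; exact I.asIdeal.zero_mem
        exact (hI.isPrime.mem_or_mem this).resolve_left h1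
      have e2 : 1 - f ∈ I.asIdeal := by
        have : f * (1 - f) ∈ I.asIdeal := by rw [mul_sub, mul_one, hf, sub_self]; exact I.asIdeal.zero_mem
        exact (hI.isPrime.mem_or_mem this).resolve_left h2
      have := I.asIdeal.sub_mem e2 e1
      have e3 : 1 - f - (1 - e) = e - f := by ring
      rwa [e3] at this
  have hc : (e - f) ^ 3 = e - f := by
    linear_combination (e + 1 - 3 * f) * he - (-3 * e + f + 1) * hf
  have hu : IsUnit (1 - (e - f) ^ 2) := by
    by_contra hn
    obtain ⟨I, hI, hmem⟩ := exists_max_ideal_of_mem_nonunits hn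
    have h1 := hg ⟨I, hI⟩
    have h2 : (e - f) ^ 2 ∈ I := by rw [pow_two]; exact I.mul_mem_left _ h1
    have := I.add_mem hmem h2
    rw [sub_add_cancel] at this
    exact hI.ne_top ((Ideal.eq_top_iff_one I).2 this)
  have h0 : (1 - (e - f) ^ 2) * (e - f) = 0 := by linear_combination - hc
  exact sub_eq_zero.1 ((hu.mul_right_eq_zero).1 h0)

theorem card_idem_le [Finite E] {F : Type*} [Field F] [Fintype F] [Algebra F E] (k : ℕ)
    (hE : Nat.card E ≤ (Fintype.card F) ^ k) : {e : E | e * e = e}.ncard ≤ 2 ^ k := by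
  have : Finite (MaximalSpectrum E) :=
    Finite.of_injective (fun I => (I.asIdeal : Set E)) (by
      intro I J h
      ext1
      exact SetLike.coe_injective h)
  have : Fintype (MaximalSpectrum E) := Fintype.ofFinite _
  have h1 := card_maxspec_le (F := F) k hE
  have h2 : {e : E | e * e = e}.ncard ≤ (Set.univ : Set (Set (MaximalSpectrum E))).ncard := by
    refine Set.ncard_le_ncard_of_injOn (fun e => {I | e ∈ I.asIdeal}) (fun _ _ => Set.mem_univ _) ?_
    intro e he f hf hef
    exact idem_sep e f he hf (fun I => by
      have := congrArg (fun s => I ∈ s) hef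
      simpa using this)
  refine h2.trans ?_
  rw [Set.ncard_univ, Nat.card_eq_fintype_card, Fintype.card_set]
  rw [Nat.card_eq_fintype_card] at h1
  exact Nat.pow_le_pow_right (by norm_num) h1

theorem card_roots_le [Finite E] (Q B : ℕ) (hQ : 2 ≤ Q) (hx : ∀ x : E, x ^ Q = x)
    (hB : {e : E | e * e = e}.ncard ≤ B) (s t : E) :
    {z : E | z * z - s * z + t = 0}.ncard ≤ B := by
  by_cases hne : {z : E | z * z - s * z + t = 0}.Nonempty
  swap
  · rw [Set.not_nonempty_iff_eq_empty.1 hne]; simp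
  obtain ⟨w, hw⟩ := hne
  refine le_trans ?_ hB
  have hid : ∀ x : E, x ^ (Q - 1) * x = x := fun x => by
    rw [← pow_succ, Nat.sub_add_cancel (by omega)]; exact hx x
  refine Set.ncard_le_ncard_of_injOn (fun z => (z - w) ^ (Q - 1)) ?_ ?_
  · intro z _
    change _ * _ = _
    have : (z - w) ^ (Q - 1) = (z - w) ^ (Q - 2) * (z - w) := by
      rw [← pow_succ]; congr 1; omega
    calc (z - w) ^ (Q - 1) * (z - w) ^ (Q - 1)
        = (z - w) ^ (Q - 2) * ((z - w) ^ (Q - 1) * (z - w)) := by rw [this]; ring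
      _ = (z - w) ^ (Q - 1) := by rw [hid, ← this]
  · intro z hz z' hz' h
    have key : ∀ z ∈ {z : E | z * z - s * z + t = 0}, z = w + (z - w) ^ (Q - 1) * (s - 2 * w) := by
      intro z hz
      have hz : z * z - s * z + t = 0 := hz
      have hw : w * w - s * w + t = 0 := hw
      have h1 : (z - w) * (z + w - s) = 0 := by linear_combination hz - hw
      have h2 : (z - w) ^ (Q - 1) * (z + w - s) = 0 := by
        have : (z - w) ^ (Q - 1) = (z - w) ^ (Q - 2) * (z - w) := by
          rw [← pow_succ]; congr 1; omega
        rw [this, mul_assoc, h1, mul_zero]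
      linear_combination h2 - hid (z - w)
    rw [key z hz, key z' hz']
    simp only at h
    rw [h]
end ringE
end SpIdx

namespace SpIdx
open Matrix

theorem frob_fix {F ι : Type*} [Field F] [Fintype F] [Fintype ι] [DecidableEq ι]
    (S : Set (Matrix ι ι F)) (hcomm : ∀ a ∈ S, ∀ b ∈ S, a * b = b * a) (N : ℕ)
    (hN : N.Coprime (ringChar F)) (hS : ∀ a ∈ S, a ^ N = 1) :
    ∃ Q : ℕ, 2 ≤ Q ∧ ∀ x ∈ Algebra.adjoin F S, x ^ Q = x := by
  obtain ⟨p, hp⟩ := CharP.exists F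
  have hpp : p.Prime := CharP.char_is_prime F p
  have : Fact p.Prime := ⟨hpp⟩
  rw [ringChar.eq F p] at hN
  obtain ⟨n, -, hn⟩ := FiniteField.card F p
  rcases isEmpty_or_nonempty ι with hι | hι
  · exact ⟨2, le_rfl, fun x _ => Subsingleton.elim _ _⟩
  have hNpos : 0 < N := by
    rcases Nat.eq_zero_or_pos N with h | h
    · subst h
      rw [Nat.coprime_zero_left] at hN
      exact absurd hN hpp.one_lt.ne'
    · exact h
  have hcop : (Fintype.card F).Coprime N := by rw [hn]; exact (Nat.Coprime.pow_right _ hN).symm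
  have ht : (Fintype.card F) ^ (Nat.totient N) ≡ 1 [MOD N] := Nat.ModEq.pow_totient hcop
  set d := Nat.totient N with hd
  have hdpos : 0 < d := Nat.totient_pos.2 hNpos
  refine ⟨(Fintype.card F) ^ d, ?_, ?_⟩
  · calc 2 ≤ Fintype.card F := Fintype.one_lt_card
      _ ≤ _ := Nat.le_self_pow hdpos.ne' _
  have hQ : (Fintype.card F) ^ d = p ^ (n * d : ℕ) := by rw [hn, pow_mul]
  have hcomm' : ∀ x ∈ Algebra.adjoin F S, ∀ y ∈ Algebra.adjoin F S, Commute x y := by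
    intro x hx y hy
    have := (Algebra.isMulCommutative_adjoin F hcomm).is_comm.comm ⟨x, hx⟩ ⟨y, hy⟩
    exact congrArg Subtype.val this
  have : CharP (Matrix ι ι F) p := inferInstance
  intro x hx
  induction hx using Algebra.adjoin_induction with
  | mem x hx =>
    obtain ⟨c, hc⟩ : ∃ c, (Fintype.card F) ^ d = 1 + N * c := by
      have h1 : 1 ≤ (Fintype.card F) ^ d := Nat.one_le_pow _ _ Fintype.card_pos
      obtain ⟨c, hc⟩ := (Nat.modEq_iff_dvd' h1).1 ht.symm
      exact ⟨c, by omega⟩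
    rw [hc, pow_add, pow_one, pow_mul, hS x hx, one_pow, mul_one]
  | algebraMap r =>
    rw [← map_pow, FiniteField.pow_card_pow]
  | add x y hx hy ihx ihy =>
    rw [hQ, add_pow_char_pow_of_commute _ _ (hcomm' x hx y hy), ← hQ, ihx, ihy]
  | mul x y hx hy ihx ihy =>
    rw [(hcomm' x hx y hy).mul_pow, ihx, ihy]

theorem card_commsub_le {F ι : Type*} [Field F] [Fintype F] [Fintype ι] [DecidableEq ι]
    (E : Subalgebra F (Matrix ι ι F)) (hcomm : ∀ a ∈ E, ∀ b ∈ E, a * b = b * a) (Q : ℕ) (hQ : 2 ≤ Q)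
    (hE : ∀ x ∈ E, x ^ Q = x) : Nat.card E ≤ (Fintype.card F) ^ (Fintype.card ι) := by
  classical
  obtain ⟨v, hv⟩ := Finite.exists_min (fun v : ι → F => {x : E | (x : Matrix ι ι F) *ᵥ v = 0}.ncard)
  have hinj : Function.Injective (fun x : E => (x : Matrix ι ι F) *ᵥ v) := by
    have key : ∀ x : E, (x : Matrix ι ι F) *ᵥ v = 0 → x = 0 := by
      intro x hx
      by_contra hx0
      let e : E := x ^ (Q - 1)
      have hex : e * x = x := by
        have : e * x = x ^ Q := by simp only [e]; rw [← pow_succ, Nat.sub_add_cancel (by omega)]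
        rw [this]
        ext1
        simpa using hE x x.2
      have he0 : e ≠ 0 := by
        intro h; rw [h, zero_mul] at hex; exact hx0 hex.symm
      have hex2 : e = x ^ (Q - 2) * x := by
        simp only [e]; rw [← pow_succ]; congr 1; omega
      have hee : e * e = e := by
        have hxe : x * e = e * x := by ext1; exact hcomm _ x.2 _ e.2
        calc e * e = x ^ (Q - 2) * (x * e) := by rw [← mul_assoc, ← hex2]
          _ = e := by rw [hxe, hex, ← hex2]
      have hev : (e : Matrix ι ι F) *ᵥ v = 0 := by
        rw [hex2]
        simp [← Matrix.mulVec_mulVec, hx]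
      have hne : (e : Matrix ι ι F) ≠ 0 := fun h => he0 (by ext1; exact h)
      obtain ⟨u, hu⟩ : ∃ u, (e : Matrix ι ι F) *ᵥ u ≠ 0 := by
        by_contra! hall
        apply hne
        exact Matrix.ext_of_mulVec_single fun i => by rw [hall, Matrix.zero_mulVec]
      have hee' : (e : Matrix ι ι F) * e = e := congrArg Subtype.val hee
      have hlt : {x : E | (x : Matrix ι ι F) *ᵥ (v + (e : Matrix ι ι F) *ᵥ u) = 0}.ncard <
          {x : E | (x : Matrix ι ι F) *ᵥ v = 0}.ncard := by
        refine Set.ncard_lt_ncard ⟨?_, ?_⟩ (Set.toFinite _)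
        · intro y hy
          have hy : (y : Matrix ι ι F) *ᵥ (v + (e : Matrix ι ι F) *ᵥ u) = 0 := hy
          change (y : Matrix ι ι F) *ᵥ v = 0
          have h1 : (e : Matrix ι ι F) *ᵥ ((y : Matrix ι ι F) *ᵥ (v + (e : Matrix ι ι F) *ᵥ u)) = 0 := by
            rw [hy, Matrix.mulVec_zero]
          rw [Matrix.mulVec_mulVec, hcomm _ e.2 _ y.2, ← Matrix.mulVec_mulVec, Matrix.mulVec_add,
            hev, zero_add, Matrix.mulVec_mulVec _ (e : Matrix ι ι F) (e : Matrix ι ι F), hee'] at h1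
          rw [Matrix.mulVec_add, h1, add_zero] at hy
          exact hy
        · intro hsub
          have h1 := hsub (show e ∈ {x : E | (x : Matrix ι ι F) *ᵥ v = 0} from hev)
          have h1 : (e : Matrix ι ι F) *ᵥ (v + (e : Matrix ι ι F) *ᵥ u) = 0 := h1
          rw [Matrix.mulVec_add, hev, zero_add, Matrix.mulVec_mulVec, hee'] at h1
          exact hu h1
      exact absurd (hv _) (not_le.2 hlt)
    intro x y hxy
    have : x - y = 0 := key _ (by
      simp only at hxy
      simp [Matrix.sub_mulVec, hxy])
    exact sub_eq_zero.1 this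
  have := Nat.card_le_card_of_injective _ hinj
  simpa using this

theorem abelian_bound {m : ℕ} {F : Type*} [Field F] [Fintype F] (hp : 3 < ringChar F)
    (Z : Subgroup (symplecticGroup (Fin m) F)) (hcomm : ∀ a ∈ Z, ∀ b ∈ Z, a * b = b * a)
    (hZ : (Nat.card Z).Coprime (ringChar F)) :
    Nat.card Z ≤ 2 ^ (2 * m) * (Fintype.card F) ^ m := by
  classical
  let S : Set (Matrix (Fin m ⊕ Fin m) (Fin m ⊕ Fin m) F) := {x | ∃ z ∈ Z, x = z.1}
  have hScomm : ∀ a ∈ S, ∀ b ∈ S, a * b = b * a := by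
    rintro _ ⟨a, ha, rfl⟩ _ ⟨b, hb, rfl⟩
    exact congrArg Subtype.val (hcomm a ha b hb)
  have hSpow : ∀ a ∈ S, a ^ (Nat.card Z) = 1 := by
    rintro _ ⟨a, ha, rfl⟩
    have h1 : (⟨a, ha⟩ : Z) ^ (Nat.card Z) = 1 := pow_card_eq_one'
    generalize Nat.card Z = n at h1
    have h2 := congrArg (fun z : Z => z.1.1) h1
    simpa using h2
  obtain ⟨Q, hQ2, hQ⟩ := frob_fix S hScomm _ hZ hSpow
  let E := Algebra.adjoin F S
  let _i : CommRing E := { (inferInstance : Ring E) with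
    mul_comm := (Algebra.isMulCommutative_adjoin F hScomm).is_comm.comm }
  have hEcomm : ∀ a ∈ E, ∀ b ∈ E, a * b = b * a := by
    intro x hx y hy
    exact congrArg Subtype.val (mul_comm (⟨x, hx⟩ : E) ⟨y, hy⟩)
  have hE : Nat.card E ≤ (Fintype.card F) ^ (2 * m) := by
    have := card_commsub_le E hEcomm Q hQ2 hQ
    simpa [two_mul] using this
  have hB := card_idem_le (E := E) (F := F) (2 * m) hE
  have hroots := card_roots_le (E := E) Q _ hQ2 (fun x => by ext1; simpa using hQ x x.2) hB
  let J' : Matrix (Fin m ⊕ Fin m) (Fin m ⊕ Fin m) F := Matrix.J (Fin m) F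
  let Ep : Set E := {x | -J' * x.1ᵀ * J' = x.1}
  let Em : Set E := {x | -J' * x.1ᵀ * J' = -x.1}
  have h2 : (2 : F) ≠ 0 := by
    intro h
    have : ringChar F ∣ 2 := (ringChar.spec F 2).1 (by exact_mod_cast h)
    have := Nat.le_of_dvd (by norm_num) this
    omega
  have hprod : Ep.ncard * Em.ncard ≤ (Fintype.card F) ^ (2 * m) := by
    rw [← Set.ncard_prod]
    refine le_trans ?_ hE
    rw [← Set.ncard_univ]
    refine Set.ncard_le_ncard_of_injOn (fun x : E × E => x.1 + x.2) (fun _ _ => Set.mem_univ _) ?_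
    rintro ⟨a, b⟩ ⟨ha, hb⟩ ⟨c, d⟩ ⟨hc, hd⟩ h
    have ha : -J' * a.1ᵀ * J' = a.1 := ha
    have hb : -J' * b.1ᵀ * J' = -b.1 := hb
    have hc : -J' * c.1ᵀ * J' = c.1 := hc
    have hd : -J' * d.1ᵀ * J' = -d.1 := hd
    have h : a.1 + b.1 = c.1 + d.1 := congrArg Subtype.val h
    have h' : -J' * (a.1 + b.1)ᵀ * J' = -J' * (c.1 + d.1)ᵀ * J' := by rw [h]
    rw [Matrix.transpose_add, Matrix.transpose_add, mul_add, mul_add, add_mul, add_mul, ha, hb, hc, hd] at h'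
    have h3 : (2:F) • a.1 = (2:F) • c.1 := by
      rw [two_smul, two_smul]
      have := congrArg₂ (· + ·) h h'
      calc a.1 + a.1 = (a.1 + b.1) + (a.1 + -b.1) := by abel
        _ = (c.1 + d.1) + (c.1 + -d.1) := this
        _ = _ := by abel
    have hac : a.1 = c.1 := smul_right_injective _ h2 h3
    have hbd : b.1 = d.1 := by rw [hac] at h; exact add_left_cancel h
    exact Prod.ext (Subtype.ext hac) (Subtype.ext hbd)
  have hmin : Ep.ncard ≤ (Fintype.card F) ^ m ∨ Em.ncard ≤ (Fintype.card F) ^ m := by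
    by_contra! hh
    have := Nat.mul_lt_mul_of_le_of_lt hh.1.le hh.2 (lt_of_le_of_lt (Nat.zero_le _) hh.1)
    rw [← pow_add, ← two_mul] at this
    omega
  -- embed Z in E
  have hmem : ∀ z : Z, z.1.1 ∈ E := fun z =>
    Algebra.subset_adjoin ⟨z, z.2, rfl⟩
  let ζ : Z → E := fun z => ⟨_, hmem z⟩
  have ζinj : Function.Injective ζ := by
    intro x y h
    ext1; ext1
    exact congrArg (fun e : E => e.1) h
  have ζinv : ∀ z, ζ z * ζ z⁻¹ = 1 := by
    intro z
    ext1
    exact congrArg (fun z : Z => z.1.1) (mul_inv_cancel z)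
  have hσ : ∀ z : Z, -J' * (ζ z).1ᵀ * J' = (ζ z⁻¹).1 := by
    intro z
    have := SymplecticGroup.coe_inv (z : symplecticGroup (Fin m) F)
    change _ = (z⁻¹ : Z).1.1
    rw [Subgroup.coe_inv, this]
  have hσ' : ∀ z : Z, -J' * (ζ z⁻¹).1ᵀ * J' = (ζ z).1 := by
    intro z; rw [hσ, inv_inv]
  have fib : ∀ (T : Set E) (f : Z → E), (∀ z, f z ∈ T) → T.ncard ≤ (Fintype.card F) ^ m →
      (∀ s, {z | f z = s}.ncard ≤ 2 ^ (2 * m)) → Nat.card Z ≤ 2 ^ (2 * m) * (Fintype.card F) ^ m := by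
    intro T f hfT hT hf
    have : Fintype Z := Fintype.ofFinite _
    have : Fintype E := Fintype.ofFinite _
    have := Finset.card_le_mul_card_image_of_maps_to (s := (Finset.univ : Finset Z)) (t := T.toFinset)
      (f := f) (fun z _ => by simpa using hfT z) (2 ^ (2 * m)) (by
        intro s _
        have := hf s
        rw [Set.ncard_eq_toFinset_card'] at this
        refine le_trans (le_of_eq ?_) this
        congr 1
        ext; simp)
    rw [Nat.card_eq_fintype_card, ← Finset.card_univ]
    refine this.trans (Nat.mul_le_mul_left _ ?_)
    rwa [Set.ncard_eq_toFinset_card'] at hT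
  rcases hmin with hp | hm
  · refine fib Ep (fun z => ζ z + ζ z⁻¹) ?_ hp ?_
    · intro z
      change -J' * ((ζ z).1 + (ζ z⁻¹).1)ᵀ * J' = (ζ z).1 + (ζ z⁻¹).1
      rw [Matrix.transpose_add, mul_add, add_mul, hσ, hσ', add_comm]
    · intro s
      refine le_trans ?_ (hroots s 1)
      refine Set.ncard_le_ncard_of_injOn ζ ?_ ζinj.injOn
      rintro z rfl
      change _ - _ + _ = _
      linear_combination -ζinv z
  · refine fib Em (fun z => ζ z - ζ z⁻¹) ?_ hm ?_
    · intro z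
      change -J' * ((ζ z).1 - (ζ z⁻¹).1)ᵀ * J' = -((ζ z).1 - (ζ z⁻¹).1)
      rw [Matrix.transpose_sub, mul_sub, sub_mul, hσ, hσ', neg_sub]
    · intro s
      refine le_trans ?_ (hroots s (-1))
      refine Set.ncard_le_ncard_of_injOn ζ ?_ ζinj.injOn
      rintro z rfl
      change _ - _ + _ = _
      linear_combination ζinv z
end SpIdx

namespace SpIdx
open Matrix

theorem coprime_bound (m : ℕ) : ∃ C : ℕ, ∀ (F : Type) [Field F] [Fintype F], 3 < ringChar F →
    ∀ K : Subgroup (symplecticGroup (Fin m) F), (Nat.card K).Coprime (ringChar F) →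
      Nat.card K ≤ C * (Fintype.card F) ^ m := by
  obtain ⟨J, hJ⟩ := jordan_coprime (2 * m)
  refine ⟨J * 2 ^ (2 * m), fun F _ _ hp K hK => ?_⟩
  let ρ : K →* Matrix (Fin m ⊕ Fin m) (Fin m ⊕ Fin m) F :=
    (Submonoid.subtype (symplecticGroup (Fin m) F)).comp K.subtype
  obtain ⟨Z, h1, h2⟩ := hJ F K (Fin m ⊕ Fin m) ρ (by simp [two_mul]) hK
  have hZ : Nat.card (Z.map K.subtype) = Nat.card Z :=
    Nat.card_congr (Z.equivMapOfInjective K.subtype K.subtype_injective).symm.toEquiv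
  have h3 := abelian_bound hp (Z.map K.subtype) (by
    rintro _ ⟨a, ha, rfl⟩ _ ⟨b, hb, rfl⟩
    ext1
    exact h2 a ha b hb) (by
    rw [hZ]
    exact Nat.Coprime.coprime_dvd_left (Subgroup.card_subgroup_dvd_card Z) hK)
  rw [hZ] at h3
  calc Nat.card K = Z.index * Nat.card Z := (Subgroup.index_mul_card Z).symm
    _ ≤ J * (2 ^ (2 * m) * Fintype.card F ^ m) := Nat.mul_le_mul h1 h3
    _ = _ := by ring
end SpIdx

set_option linter.all false
set_option linter.unusedSectionVars false
set_option linter.unusedVariables false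
namespace SpIdx
open Matrix

abbrev Pos (m : ℕ) := Fin m ⊕ Fin m
abbrev Mt (m : ℕ) (F : Type) := Matrix (Pos m) (Pos m) F
abbrev Sp (m : ℕ) (F : Type) [Field F] := symplecticGroup (Fin m) F

variable {m : ℕ} {F : Type} [Field F]

/-- sign of a position -/
def sg (F : Type) [Field F] : Pos m → F := Sum.elim (fun _ => 1) (fun _ => -1)

def om (x y : Pos m → F) : F := x ⬝ᵥ ((-Matrix.J (Fin m) F) *ᵥ y)

theorem sg_sq (z : Pos m) : sg F z * sg F z = 1 := by rcases z with i | i <;> simp [sg]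
theorem sg_ne (z : Pos m) : sg F z ≠ 0 := by rcases z with i | i <;> simp [sg]
theorem sg_swap (z : Pos m) : sg F z.swap = - sg F z := by rcases z with i | i <;> simp [sg]

theorem negJ_mulVec (y : Pos m → F) (z : Pos m) :
    ((-Matrix.J (Fin m) F) *ᵥ y) z = sg F z * y z.swap := by
  rcases z with i | i <;>
  simp [Matrix.J, sg, Matrix.neg_mulVec, Matrix.fromBlocks_mulVec]

theorem om_eq (x y : Pos m → F) : om x y = ∑ z, sg F z * x z * y z.swap := by
  unfold om
  simp only [dotProduct, negJ_mulVec]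
  exact Finset.sum_congr rfl fun z _ => by ring

theorem om_add_left (x x' y : Pos m → F) : om (x + x') y = om x y + om x' y := by
  simp [om, add_dotProduct]
theorem om_add_right (x y y' : Pos m → F) : om x (y + y') = om x y + om x y' := by
  simp only [om, mulVec_add, dotProduct_add]
theorem om_smul_left (c : F) (x y : Pos m → F) : om (c • x) y = c * om x y := by
  simp [om, smul_dotProduct]
theorem om_smul_right (c : F) (x y : Pos m → F) : om x (c • y) = c * om x y := by
  simp only [om, mulVec_smul, dotProduct_smul, smul_eq_mul]
theorem om_zero_left (y : Pos m → F) : om 0 y = 0 := by simp [om]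
theorem om_zero_right (y : Pos m → F) : om y 0 = 0 := by simp [om]
theorem om_sub_left (x x' y : Pos m → F) : om (x - x') y = om x y - om x' y := by
  simp [om, sub_dotProduct]
theorem om_sub_right (x y y' : Pos m → F) : om x (y - y') = om x y - om x y' := by
  simp only [om, mulVec_sub, dotProduct_sub]
theorem om_swap (x y : Pos m → F) : om x y = - om y x := by
  rw [om_eq, om_eq, ← Finset.sum_neg_distrib]
  refine Fintype.sum_equiv (Equiv.sumComm _ _) _ _ fun z => ?_
  change _ = -(sg F z.swap * y z.swap * x z.swap.swap)
  rw [sg_swap, Sum.swap_swap]; ring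
theorem om_self (h2 : (2:F) ≠ 0) (x : Pos m → F) : om x x = 0 := by
  have := om_swap x x
  have h : 2 * om x x = 0 := by linear_combination this
  exact (mul_eq_zero.1 h).resolve_left h2

/-- basis vector -/
abbrev bv (z : Pos m) : Pos m → F := Pi.single z 1

theorem om_bv_left (z : Pos m) (y : Pos m → F) : om (bv z) y = sg F z * y z.swap := by
  rw [om_eq, Finset.sum_eq_single z]
  · simp
  · intro b _ hb; simp [bv, hb]
  · simp
theorem om_bv_right (z : Pos m) (y : Pos m → F) : om y (bv z) = - (sg F z * y z.swap) := by
  rw [om_swap, om_bv_left]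

theorem om_ext (x x' : Pos m → F) (h : ∀ y, om y x = om y x') : x = x' := by
  funext z
  have := h (bv z.swap)
  rw [om_bv_left, om_bv_left, Sum.swap_swap] at this
  exact mul_left_cancel₀ (sg_ne _) this

theorem om_mulVec (A : Mt m F) (x y : Pos m → F) :
    om (A *ᵥ x) (A *ᵥ y) = x ⬝ᵥ ((Aᵀ * (-Matrix.J (Fin m) F) * A) *ᵥ y) := by
  unfold om
  rw [← vecMul_transpose, ← dotProduct_mulVec, mulVec_mulVec, mulVec_mulVec]

theorem mem_Sp_iff (A : Mt m F) :
    A ∈ symplecticGroup (Fin m) F ↔ ∀ x y, om (A *ᵥ x) (A *ᵥ y) = om x y := by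
  rw [SymplecticGroup.mem_iff']
  constructor
  · intro h x y
    rw [om_mulVec, mul_neg, neg_mul, h]; rfl
  · intro h
    have h1 : Aᵀ * (-Matrix.J (Fin m) F) * A = -Matrix.J (Fin m) F := by
      ext i j
      have := h (bv i) (bv j)
      rw [om_mulVec] at this
      unfold om at this
      simpa only [bv, mulVec_single_one, single_one_dotProduct, col_apply] using this
    rw [mul_neg, neg_mul] at h1
    exact neg_injective h1

theorem om_Sp (g : Sp m F) (x y : Pos m → F) : om (g.1 *ᵥ x) (g.1 *ᵥ y) = om x y :=
  (mem_Sp_iff g.1).1 g.2 x y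

theorem inv_mulVec_mulVec (g : Sp m F) (x : Pos m → F) : (g⁻¹).1 *ᵥ (g.1 *ᵥ x) = x := by
  rw [mulVec_mulVec]
  have : (g⁻¹).1 * g.1 = 1 := congrArg Subtype.val (inv_mul_cancel g)
  rw [this, one_mulVec]
theorem mulVec_inv_mulVec (g : Sp m F) (x : Pos m → F) : g.1 *ᵥ ((g⁻¹).1 *ᵥ x) = x := by
  rw [mulVec_mulVec]
  have : g.1 * (g⁻¹).1 = 1 := congrArg Subtype.val (mul_inv_cancel g)
  rw [this, one_mulVec]

theorem om_inv_left (g : Sp m F) (x y : Pos m → F) : om ((g⁻¹).1 *ᵥ x) y = om x (g.1 *ᵥ y) := by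
  rw [← om_Sp g, mulVec_inv_mulVec]

theorem entry (A : Mt m F) (x z : Pos m) : A x z = (A *ᵥ bv z) x := by
  simp [bv, mulVec_single_one]

/-- entries of the inverse -/
theorem inv_entry (g : Sp m F) (x z : Pos m) :
    (g⁻¹).1 x z = sg F x * sg F z * g.1 z.swap x.swap := by
  have h1 := om_inv_left g (bv z) (bv x.swap)
  rw [om_bv_right, om_bv_left, Sum.swap_swap, sg_swap, ← entry, ← entry] at h1
  have := sg_sq (F := F) x
  linear_combination sg F x * h1 - (g⁻¹).1 x z * this

/-- Linear map (matrix) associated with a function -/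
theorem mat_of_lin (f : (Pos m → F) →ₗ[F] (Pos m → F)) (y : Pos m → F) :
    (LinearMap.toMatrix' f) *ᵥ y = f y := by
  rw [← Matrix.toLin'_apply, Matrix.toLin'_toMatrix']

/-- keys -/
structure Key (m : ℕ) where
  k : Pos m → ℤ
  odd : ∀ x, k x.swap = - k x
  inj : Function.Injective k

theorem Key.le_swap (K : Key m) {x y : Pos m} : K.k x.swap ≤ K.k y.swap ↔ K.k y ≤ K.k x := by
  rw [K.odd, K.odd]; omega
theorem Key.lt_swap (K : Key m) {x y : Pos m} : K.k x.swap < K.k y.swap ↔ K.k y < K.k x := by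
  rw [K.odd, K.odd]; omega

/-- Borel subgroup of a key -/
def Bor (F : Type) [Field F] (K : Key m) : Subgroup (Sp m F) where
  carrier := {g | ∀ x z, K.k z < K.k x → g.1 x z = 0}
  one_mem' := by
    intro x z h
    have : x ≠ z := by rintro rfl; omega
    change (1 : Mt m F) x z = 0
    simp [this]
  mul_mem' := by
    intro a b ha hb x z h
    change (a.1 * b.1) x z = 0
    rw [Matrix.mul_apply]
    refine Finset.sum_eq_zero fun y _ => ?_
    rcases lt_or_ge (K.k y) (K.k x) with h1 | h1
    · rw [ha x y h1, zero_mul]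
    · rw [hb y z (by omega), mul_zero]
  inv_mem' := by
    intro a ha x z h
    rw [inv_entry, ha _ _ (K.lt_swap.2 h), mul_zero]

theorem Bor_diag_mul {K : Key m} {a b : Sp m F} (ha : a ∈ Bor F K) (hb : b ∈ Bor F K) (x : Pos m) :
    (a * b).1 x x = a.1 x x * b.1 x x := by
  change (a.1 * b.1) x x = _
  rw [Matrix.mul_apply, Finset.sum_eq_single x]
  · intro y _ hy
    rcases lt_trichotomy (K.k y) (K.k x) with h1 | h1 | h1
    · rw [ha x y h1, zero_mul]
    · exact absurd (K.inj h1) hy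
    · rw [hb y x h1, mul_zero]
  · simp

theorem Bor_diag_inv (a : Sp m F) (x : Pos m) :
    (a⁻¹).1 x x = a.1 x.swap x.swap := by
  rw [inv_entry, sg_sq, one_mul]

theorem Bor_diag_ne {K : Key m} {a : Sp m F} (ha : a ∈ Bor F K) (x : Pos m) : a.1 x x ≠ 0 := by
  intro h
  have := Bor_diag_mul ha ((Bor F K).inv_mem ha) x
  rw [h, zero_mul, mul_inv_cancel] at this
  change (1 : Mt m F) x x = 0 at this
  simp at this

theorem Bor_diag_swap {K : Key m} {a : Sp m F} (ha : a ∈ Bor F K) (x : Pos m) :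
    a.1 x.swap x.swap = (a.1 x x)⁻¹ := by
  have := Bor_diag_mul ha ((Bor F K).inv_mem ha) x
  rw [mul_inv_cancel, Bor_diag_inv] at this
  change (1 : Mt m F) x x = _ at this
  rw [one_apply_eq] at this
  exact (DivisionMonoid.inv_eq_of_mul _ _ this.symm).symm

/-- unipotent radical -/
def Uni (F : Type) [Field F] (K : Key m) : Subgroup (Sp m F) where
  carrier := {g | g ∈ Bor F K ∧ ∀ x, g.1 x x = 1}
  one_mem' := ⟨(Bor F K).one_mem, fun x => by change (1 : Mt m F) x x = 1; simp⟩
  mul_mem' := by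
    rintro a b ⟨ha, ha'⟩ ⟨hb, hb'⟩
    exact ⟨(Bor F K).mul_mem ha hb, fun x => by rw [Bor_diag_mul ha hb, ha', hb', one_mul]⟩
  inv_mem' := by
    rintro a ⟨ha, ha'⟩
    exact ⟨(Bor F K).inv_mem ha, fun x => by rw [Bor_diag_inv, ha']⟩

/-- `a` on `v`, `a⁻¹` on `u` -/
def dil (v u : Pos m → F) (a : F) : (Pos m → F) →ₗ[F] (Pos m → F) where
  toFun y := y + ((a - 1) * om y u) • v + ((a⁻¹ - 1) * om v y) • u
  map_add' x y := by
    rw [om_add_left, om_add_right]; module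
  map_smul' c y := by
    rw [om_smul_left, om_smul_right, RingHom.id_apply]; module

theorem dil_mem (h2 : (2:F) ≠ 0) (v u : Pos m → F) (h : om v u = 1) (a : F) (ha : a ≠ 0) :
    LinearMap.toMatrix' (dil v u a) ∈ symplecticGroup (Fin m) F := by
  rw [mem_Sp_iff]
  intro x y
  rw [mat_of_lin, mat_of_lin]
  simp only [dil, LinearMap.coe_mk, AddHom.coe_mk, om_add_left, om_add_right, om_smul_left,
    om_smul_right, om_self h2, h, om_swap u v, om_swap u y, om_swap x v]
  field_simp
  ring

def dilS (h2 : (2:F) ≠ 0) (v u : Pos m → F) (h : om v u = 1) (a : F) (ha : a ≠ 0) : Sp m F :=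
  ⟨_, dil_mem h2 v u h a ha⟩

theorem dilS_mulVec (h2 : (2:F) ≠ 0) (v u : Pos m → F) (h : om v u = 1) (a : F) (ha : a ≠ 0)
    (y : Pos m → F) : (dilS h2 v u h a ha).1 *ᵥ y
      = y + ((a - 1) * om y u) • v + ((a⁻¹ - 1) * om v y) • u :=
  mat_of_lin _ _

theorem Sp_ext {g h : Sp m F} (H : ∀ y, g.1 *ᵥ y = h.1 *ᵥ y) : g = h := by
  ext1
  exact Matrix.ext_of_mulVec_single fun i => H _

theorem Sp_mul_mulVec (g h : Sp m F) (y : Pos m → F) : (g * h).1 *ᵥ y = g.1 *ᵥ (h.1 *ᵥ y) := by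
  rw [mulVec_mulVec]; rfl

theorem dilS_conj (h2 : (2:F) ≠ 0) (v u : Pos m → F) (h : om v u = 1) (a : F) (ha : a ≠ 0)
    (x : Sp m F) (h' : om (x.1 *ᵥ v) (x.1 *ᵥ u) = 1) :
    dilS h2 _ _ h' a ha * x = x * dilS h2 v u h a ha := by
  apply Sp_ext
  intro y
  rw [Sp_mul_mulVec, Sp_mul_mulVec, dilS_mulVec, dilS_mulVec, om_Sp, om_Sp]
  simp only [mulVec_add, mulVec_smul]

theorem dilS_diag (h2 : (2:F) ≠ 0) (K : Key m) (v u : Pos m → F) (h : om v u = 1) (a : F) (ha : a ≠ 0)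
    (j : Pos m) (hv : ∀ r, K.k j < K.k r → v r = 0) (hu : ∀ r, K.k j.swap < K.k r → u r = 0) :
    dilS h2 v u h a ha ∈ Bor F K ∧ (dilS h2 v u h a ha).1 j j = a ∧
      (dilS h2 v u h a ha).1 j.swap j.swap = a⁻¹ ∧
      ∀ r, r ≠ j → r ≠ j.swap → (dilS h2 v u h a ha).1 r r = 1 := by
  have ent : ∀ r s, (dilS h2 v u h a ha).1 r s = (1 : Mt m F) r s +
      ((a - 1) * (sg F s * u s.swap)) * v r - ((a⁻¹ - 1) * (sg F s * v s.swap)) * u r := by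
    intro r s
    rw [entry (dilS h2 v u h a ha).1 r s, dilS_mulVec, om_bv_left, om_bv_right]
    simp only [Pi.add_apply, Pi.smul_apply, smul_eq_mul, Matrix.one_apply, Pi.single_apply]
    ring
  have hjs : j ≠ j.swap := by rcases j with i | i <;> simp
  have hkj : K.k j ≠ K.k j.swap := fun e => hjs (K.inj e)
  have z1 : ∀ r s, ¬ (K.k r ≤ K.k j ∧ K.k j ≤ K.k s) → u s.swap * v r = 0 := by
    intro r s hrs
    by_cases h1 : K.k r ≤ K.k j
    · rw [hu _ (K.lt_swap.2 (by by_contra h3; exact hrs ⟨h1, by omega⟩)), zero_mul]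
    · rw [hv r (by omega), mul_zero]
  have z2 : ∀ r s, ¬ (K.k r ≤ K.k j.swap ∧ K.k j.swap ≤ K.k s) → v s.swap * u r = 0 := by
    intro r s hrs
    by_cases h1 : K.k r ≤ K.k j.swap
    · rw [hv, zero_mul]
      by_contra h3
      have : K.k s.swap ≤ K.k j.swap.swap := by rw [Sum.swap_swap]; omega
      exact hrs ⟨h1, K.le_swap.1 this⟩
    · rw [hu r (by omega), mul_zero]
  have hone : sg F j * v j * u j.swap = 1 := by
    rw [om_eq, Finset.sum_eq_single j] at h
    · exact h
    · intro z _ hz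
      have := z1 z z (fun h3 => hz (K.inj (by omega)))
      linear_combination sg F z * this
    · simp
  refine ⟨?_, ?_, ?_, ?_⟩
  · intro r s hrs
    have : r ≠ s := by rintro rfl; omega
    rw [ent, Matrix.one_apply_ne this]
    linear_combination ((a - 1) * sg F s) * z1 r s (by omega) - ((a⁻¹ - 1) * sg F s) * z2 r s (by omega)
  · rw [ent, one_apply_eq]
    linear_combination (a - 1) * hone - ((a⁻¹ - 1) * sg F j) * z2 j j (by omega)
  · rw [ent, one_apply_eq, Sum.swap_swap, sg_swap]
    have e1 := z1 j.swap j.swap (by omega)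
    rw [Sum.swap_swap] at e1
    linear_combination (a⁻¹ - 1) * hone - ((a - 1) * sg F j) * e1
  · intro r h1 h3
    have k1 : K.k r ≠ K.k j := fun e => h1 (K.inj e)
    have k2 : K.k r ≠ K.k j.swap := fun e => h3 (K.inj e)
    rw [ent, one_apply_eq]
    linear_combination ((a - 1) * sg F r) * z1 r r (by omega) - ((a⁻¹ - 1) * sg F r) * z2 r r (by omega)
end SpIdx

set_option linter.all false
set_option linter.unusedSectionVars false
set_option linter.unusedVariables false
namespace SpIdx
open Matrix

variable {m : ℕ} {F : Type} [Field F] [Fintype F]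

noncomputable instance instFintypeSp : Fintype (Sp m F) := Fintype.ofFinite _

/-- weights -/
structure Wt (m : ℕ) (F : Type) [Field F] where
  t : Pos m → MulChar F ℂ
  odd : ∀ x, t x.swap = (t x)⁻¹

/-- value of the weight on a matrix -/
noncomputable def ev (θ : Wt m F) (g : Sp m F) : ℂ := ∏ i : Fin m, θ.t (Sum.inl i) (g.1 (Sum.inl i) (Sum.inl i))

theorem ev_mul (θ : Wt m F) {K : Key m} {a b : Sp m F} (ha : a ∈ Bor F K) (hb : b ∈ Bor F K) :
    ev θ (a * b) = ev θ a * ev θ b := by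
  unfold ev
  rw [← Finset.prod_mul_distrib]
  exact Finset.prod_congr rfl fun i _ => by rw [Bor_diag_mul ha hb, map_mul]

theorem ev_one (θ : Wt m F) : ev θ (1 : Sp m F) = 1 := by
  unfold ev
  refine Finset.prod_eq_one fun i _ => ?_
  change θ.t _ ((1 : Mt m F) _ _) = 1
  simp

theorem ev_of_uni (θ : Wt m F) {g : Sp m F} (h : ∀ x, g.1 x x = 1) : ev θ g = 1 := by
  unfold ev
  refine Finset.prod_eq_one fun i _ => ?_
  rw [h, map_one]

theorem ev_diag (θ : Wt m F) (g : Sp m F) (a : F) (ha : a ≠ 0) (j : Pos m) (h1 : g.1 j j = a)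
    (h2 : g.1 j.swap j.swap = a⁻¹) (h3 : ∀ r, r ≠ j → r ≠ j.swap → g.1 r r = 1) :
    ev θ g = θ.t j a := by
  unfold ev
  rcases j with i | i
  · rw [Finset.prod_eq_single i, h1]
    · intro b _ hb
      rw [h3 _ (by simpa using hb) (by simp), map_one]
    · simp
  · have e := θ.odd (Sum.inr i)
    simp only [Sum.swap_inr] at h2 h3 e
    rw [Finset.prod_eq_single i, h2, e, MulChar.inv_apply', inv_inv]
    · intro b _ hb
      rw [h3 _ (by simp) (by simpa using hb), map_one]
    · simp

def IsEig (K : Key m) (θ : Wt m F) (w : Sp m F → ℂ) : Prop :=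
  ∀ g, ∀ b ∈ Bor F K, w (g * b) = ev θ b * w g

noncomputable def Phi (w : Sp m F → ℂ) (x : Sp m F) : ℂ := ∑ g, w (g * x) * star (w g)

theorem Phi_conj {K : Key m} {θ : Wt m F} {w : Sp m F → ℂ} (hw : IsEig K θ w) (x b b' : Sp m F)
    (hb : b ∈ Bor F K) (hb' : b' ∈ Bor F K) (h : b' * x = x * b) :
    star (ev θ b') * ev θ b * Phi w x = Phi w x := by
  have e1 : Phi w x = ∑ g, w (g * b' * x) * star (w (g * b')) := by
    unfold Phi
    exact (Fintype.sum_equiv (Equiv.mulRight b') _ _ fun g => rfl).symm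
  conv_rhs => rw [e1]
  unfold Phi
  rw [Finset.mul_sum]
  refine Finset.sum_congr rfl fun g _ => ?_
  rw [mul_assoc g, h, ← mul_assoc g, hw _ b hb, hw _ b' hb', star_mul']
  ring

theorem pivot (h2 : (2:F) ≠ 0) {K : Key m} {θ : Wt m F} {w : Sp m F → ℂ} (hw : IsEig K θ w)
    (x : Sp m F) (hx : Phi w x ≠ 0) (j k : Pos m) (hjk : x.1 j k ≠ 0)
    (hcol : ∀ r, K.k j < K.k r → x.1 r k = 0) (hrow : ∀ y, K.k y < K.k k → x.1 j y = 0) :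
    θ.t j = θ.t k := by
  set v : Pos m → F := x.1 *ᵥ bv k with hv
  have hvr : ∀ r, v r = x.1 r k := fun r => (entry x.1 r k).symm
  set c : F := sg F j * (x.1 j k)⁻¹ with hc
  set u : Pos m → F := c • bv j.swap with hu
  have hvu : om v u = 1 := by
    rw [hu, om_smul_right, om_bv_right, Sum.swap_swap, sg_swap, hvr, hc]
    have := sg_sq (F := F) j
    field_simp
    linear_combination this
  have hk : om (bv k) ((x⁻¹).1 *ᵥ u) = 1 := by
    rw [← om_Sp x, mulVec_inv_mulVec]; exact hvu
  have hk' : om (x.1 *ᵥ bv k) (x.1 *ᵥ ((x⁻¹).1 *ᵥ u)) = 1 := by rw [om_Sp]; exact hk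
  have hur : ∀ r, ((x⁻¹).1 *ᵥ u) r = c * (sg F r * sg F j.swap * x.1 j r.swap) := by
    intro r
    rw [hu, mulVec_smul, Pi.smul_apply, ← entry, inv_entry, Sum.swap_swap, smul_eq_mul]
  apply MulChar.ext
  intro a
  have ha : (a : F) ≠ 0 := a.ne_zero
  obtain ⟨b1, b2, b3, b4⟩ := dilS_diag h2 K (bv k) ((x⁻¹).1 *ᵥ u) hk a ha k
    (by intro r hr; have : r ≠ k := by { rintro rfl; omega }
        simp [bv, this])
    (by intro r hr
        rw [hur, hrow, mul_zero, mul_zero]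
        have := K.lt_swap.2 hr
        simpa using this)
  obtain ⟨c1, c2, c3, c4⟩ := dilS_diag h2 K (x.1 *ᵥ bv k) (x.1 *ᵥ ((x⁻¹).1 *ᵥ u)) hk' a ha j
    (by intro r hr; rw [← hv, hvr, hcol r hr])
    (by intro r hr; rw [mulVec_inv_mulVec]; have : r ≠ j.swap := by { rintro rfl; omega }
        simp [hu, bv, this])
  have key := Phi_conj hw x _ _ b1 c1 (dilS_conj h2 _ _ hk a ha x hk')
  rw [ev_diag θ _ a ha k b2 b3 b4, ev_diag θ _ a ha j c2 c3 c4] at key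
  have k1 : star (θ.t j a) * θ.t k a = 1 := by
    have := mul_right_cancel₀ hx (key.trans (one_mul _).symm)
    exact this
  rw [MulChar.star_apply', MulChar.inv_apply_eq_inv'] at k1
  have n1 : θ.t j a ≠ 0 := by
    intro h; rw [h] at k1; simp at k1
  field_simp at k1
  exact k1.symm
end SpIdx

set_option linter.all false
set_option linter.unusedSectionVars false
set_option linter.unusedVariables false
namespace SpIdx
open Matrix

variable {m : ℕ} {F : Type} [Field F] [Fintype F]

theorem exists_pivot (K : Key m) (x : Sp m F) (h : x ∉ Bor F K) :
    ∃ j k, K.k k < K.k j ∧ x.1 j k ≠ 0 ∧ (∀ r, K.k j < K.k r → x.1 r k = 0) ∧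
      (∀ y, K.k y < K.k k → x.1 j y = 0) ∧ (∀ y, K.k y < K.k k → x.1 k y = 0) := by
  classical
  have h' : ∃ r k, K.k k < K.k r ∧ x.1 r k ≠ 0 := by
    by_contra hc
    push Not at hc
    exact h fun r k hrk => hc r k hrk
  obtain ⟨r0, k0, h0⟩ := h'
  obtain ⟨k, hk, hkmin⟩ := Finset.exists_min_image
    (Finset.univ.filter fun k => ∃ r, K.k k < K.k r ∧ x.1 r k ≠ 0) K.k ⟨k0, Finset.mem_filter.2 ⟨Finset.mem_univ _, r0, h0⟩⟩
  simp only [Finset.mem_filter, Finset.mem_univ, true_and] at hk hkmin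
  obtain ⟨r, hr⟩ := hk
  obtain ⟨j, hj, hjmax⟩ := Finset.exists_max_image
    (Finset.univ.filter fun r => K.k k < K.k r ∧ x.1 r k ≠ 0) K.k ⟨r, by simpa using hr⟩
  simp only [Finset.mem_filter, Finset.mem_univ, true_and] at hj hjmax
  refine ⟨j, k, hj.1, hj.2, fun s hs => ?_, fun y hy => ?_, fun y hy => ?_⟩
  · by_contra hne
    have := hjmax s ⟨by omega, hne⟩
    omega
  · by_contra hne
    have := hkmin y ⟨j, by omega, hne⟩
    omega
  · by_contra hne
    have := hkmin y ⟨k, by omega, hne⟩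
    omega

/-- torus element -/
theorem tor_mem (d : Pos m → F) (hd : ∀ x, d x * d x.swap = 1) :
    Matrix.diagonal d ∈ symplecticGroup (Fin m) F := by
  rw [mem_Sp_iff]
  intro x y
  rw [om_eq, om_eq]
  refine Finset.sum_congr rfl fun z _ => ?_
  rw [mulVec_diagonal, mulVec_diagonal]
  linear_combination (sg F z * x z * y z.swap) * hd z

def tor (d : Pos m → F) (hd : ∀ x, d x * d x.swap = 1) : Sp m F := ⟨_, tor_mem d hd⟩

theorem tor_apply (d : Pos m → F) (hd : ∀ x, d x * d x.swap = 1) (x : Pos m) :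
    (tor d hd).1 x x = d x := by
  change Matrix.diagonal d x x = d x
  simp

theorem tor_Bor (K : Key m) (d : Pos m → F) (hd : ∀ x, d x * d x.swap = 1) :
    tor d hd ∈ Bor F K := by
  intro x z h
  have : x ≠ z := by rintro rfl; omega
  change Matrix.diagonal d x z = 0
  simp [this]

theorem Phi_one_ne (w : Sp m F → ℂ) (hw : w ≠ 0) : Phi w 1 ≠ 0 := by
  intro h
  apply hw
  unfold Phi at h
  simp only [mul_one] at h
  have h3 : ∑ g, ‖w g‖ ^ 2 = 0 := by
    have : ((∑ g, ‖w g‖ ^ 2 : ℝ) : ℂ) = 0 := by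
      rw [← h]; push_cast
      refine Finset.sum_congr rfl fun g _ => ?_
      exact (Complex.mul_conj' (w g)).symm
    exact_mod_cast this
  rw [Finset.sum_eq_zero_iff_of_nonneg (fun _ _ => by positivity)] at h3
  funext g
  have := h3 g (Finset.mem_univ _)
  simpa using this

def IsLeft (H : Subgroup (Sp m F)) (χ : Sp m F → ℂ) (w : Sp m F → ℂ) : Prop :=
  ∀ h ∈ H, ∀ g, w (h * g) = χ h * w g

theorem resort (h2 : (2:F) ≠ 0) (K0 K : Key m) (θ : Wt m F) (H : Subgroup (Sp m F)) (χ w : Sp m F → ℂ)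
    (hw : IsEig K0 θ w) (hw0 : w ≠ 0) (hl : IsLeft H χ w)
    (hK : ∀ x z, θ.t x = θ.t z → K0.k x < K0.k z → K.k x < K.k z) :
    ∃ w', w' ≠ 0 ∧ IsEig K θ w' ∧ IsLeft H χ w' := by
  classical
  set U : Finset (Sp m F) := Finset.univ.filter (· ∈ Uni F K) with hU
  refine ⟨fun g => ∑ u ∈ U, w (g * u), ?_, ?_, ?_⟩
  · intro h0
    have e1 : ∑ g, (∑ u ∈ U, w (g * u)) * star (w g) = ∑ u ∈ U, Phi w u := by
      unfold Phi
      rw [Finset.sum_comm]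
      refine Finset.sum_congr rfl fun g _ => ?_
      rw [Finset.sum_mul]
    have e2 : ∑ u ∈ U, Phi w u = ∑ u ∈ U.filter (· ∈ Bor F K0), Phi w 1 := by
      refine Eq.trans ?_ (Finset.sum_filter _ _).symm
      refine Finset.sum_congr rfl fun u hu => ?_
      have hu' : u ∈ Uni F K := by simpa [hU] using hu
      split_ifs with hb
      · unfold Phi
        refine Finset.sum_congr rfl fun g _ => ?_
        rw [hw g u hb, ev_of_uni θ hu'.2, one_mul, mul_one]
      · by_contra hne
        obtain ⟨j, k, h1, h3, h4, h5, -⟩ := exists_pivot K0 u hb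
        have := pivot h2 hw u hne j k h3 h4 h5
        exact h3 (hu'.1 j k (hK k j this.symm h1))
    have e3 : ∑ g, (∑ u ∈ U, w (g * u)) * star (w g) = 0 :=
      Finset.sum_eq_zero fun g _ => by rw [congrFun h0 g]; simp
    rw [e3, e2, Finset.sum_const, nsmul_eq_mul, eq_comm, mul_eq_zero] at e1
    rcases e1 with e | e
    · rw [Nat.cast_eq_zero, Finset.card_eq_zero] at e
      have : (1 : Sp m F) ∈ U.filter (· ∈ Bor F K0) := by
        simp [hU, (Bor F K0).one_mem, (Uni F K).one_mem]
      rw [e] at this; simp at this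
    · exact Phi_one_ne w hw0 e
  · intro g b hb
    have hd : ∀ x, b.1 x x * b.1 x.swap x.swap = 1 := fun x => by
      rw [Bor_diag_swap hb, mul_inv_cancel₀ (Bor_diag_ne hb x)]
    set t := tor (fun x => b.1 x x) hd with ht
    have htev : ev θ t = ev θ b := by
      unfold ev
      refine Finset.prod_congr rfl fun i _ => ?_
      rw [ht, tor_apply]
    have htK : t ∈ Bor F K := tor_Bor K _ hd
    have htK' : t⁻¹ ∈ Bor F K := (Bor F K).inv_mem htK
    have hbi := (Bor F K).inv_mem hb
    change ∑ u ∈ U, w (g * b * u) = ev θ b * ∑ u ∈ U, w (g * u)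
    rw [Finset.mul_sum]
    refine Finset.sum_equiv ((Equiv.mulLeft b).trans (Equiv.mulRight t⁻¹)) ?_ ?_
    · intro u
      simp only [hU, Finset.mem_filter, Finset.mem_univ, true_and]
      change u ∈ Uni F K ↔ b * u * t⁻¹ ∈ Uni F K
      constructor
      · rintro ⟨h1, h3⟩
        have h4 := (Bor F K).mul_mem hb h1
        refine ⟨(Bor F K).mul_mem h4 htK', fun x => ?_⟩
        rw [Bor_diag_mul h4 htK', Bor_diag_mul hb h1, h3, mul_one, Bor_diag_inv, ht, tor_apply, hd]
      · rintro ⟨h1, h3⟩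
        have e : u = b⁻¹ * (b * u * t⁻¹) * t := by group
        have h4 := (Bor F K).mul_mem hbi h1
        rw [e]
        refine ⟨(Bor F K).mul_mem h4 htK, fun x => ?_⟩
        rw [Bor_diag_mul h4 htK, Bor_diag_mul hbi h1, h3, mul_one, Bor_diag_inv, ht, tor_apply,
          mul_comm, hd]
    · intro u hu
      change _ = ev θ b * w (g * (b * u * t⁻¹))
      rw [← htev, ← hw _ t (tor_Bor K0 _ hd)]
      congr 1
      group
  · intro h hh g
    change ∑ u ∈ U, w (h * g * u) = χ h * ∑ u ∈ U, w (g * u)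
    rw [Finset.mul_sum]
    refine Finset.sum_congr rfl fun u _ => ?_
    rw [mul_assoc, hl h hh]

theorem index_ge (h2 : (2:F) ≠ 0) (K : Key m) (θ : Wt m F) (H : Subgroup (Sp m F)) (χ w : Sp m F → ℂ)
    (hw : IsEig K θ w) (hw0 : w ≠ 0) (hl : IsLeft H χ w) (Y : Subgroup (Sp m F))
    (hY1 : ∀ y ∈ Y, y ∈ Bor F K → y = 1)
    (hY2 : ∀ y ∈ Y, ∀ j k, K.k k < K.k j → y.1 j k ≠ 0 → θ.t j ≠ θ.t k) :
    Nat.card Y ≤ H.index := by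
  classical
  let _i : Fintype (Sp m F ⧸ H) := Fintype.ofFinite _
  let _i2 : Fintype Y := Fintype.ofFinite _
  have orth : ∀ y ∈ Y, y ≠ 1 → Phi w y = 0 := by
    intro y hy hy1
    by_contra hne
    obtain ⟨j, k, h1, h3, h4, h5, -⟩ := exists_pivot K y (fun hb => hy1 (hY1 y hy hb))
    exact hY2 y hy j k h1 h3 (pivot h2 hw y hne j k h3 h4 h5)
  let f : Y → (Sp m F ⧸ H) → ℂ := fun y q => w ((q.out)⁻¹ * y.1)
  have hlin : LinearIndependent ℂ f := by
    rw [Fintype.linearIndependent_iff]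
    intro c hc y'
    have h1 : ∀ g, ∑ y, c y * w (g * y.1) = 0 := by
      intro g
      have e := congrFun hc (QuotientGroup.mk g⁻¹)
      simp only [Finset.sum_apply, Pi.smul_apply, smul_eq_mul, Pi.zero_apply, f] at e
      set o := (QuotientGroup.mk g⁻¹ : Sp m F ⧸ H).out with ho
      have hmem : o⁻¹ * g⁻¹ ∈ H := by
        rw [← QuotientGroup.eq, ho]; exact QuotientGroup.out_eq' _
      have hmem' : g * o ∈ H := by
        have := H.inv_mem hmem
        simpa [_root_.mul_inv_rev] using this
      have : ∀ y : Y, w (g * y.1) = χ (g * o) * w (o⁻¹ * y.1) := by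
        intro y
        rw [← hl _ hmem']
        congr 1; group
      simp only [this]
      rw [← mul_zero (χ (g * o)), ← e, Finset.mul_sum]
      exact Finset.sum_congr rfl fun y _ => by ring
    have h3 : ∑ g, (∑ y, c y * w (g * y.1)) * star (w (g * y'.1)) = 0 :=
      Finset.sum_eq_zero fun g _ => by rw [h1 g, zero_mul]
    have h4 : ∀ y : Y, ∑ g, w (g * y.1) * star (w (g * y'.1)) = Phi w (y'.1⁻¹ * y.1) := by
      intro y
      unfold Phi
      refine Fintype.sum_equiv (Equiv.mulRight y'.1) _ _ fun g => ?_
      simp only [Equiv.coe_mulRight]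
      congr 2; group
    have h5 : ∑ g, (∑ y, c y * w (g * y.1)) * star (w (g * y'.1)) = ∑ y, c y * Phi w (y'.1⁻¹ * y.1) := by
      simp only [← h4, Finset.sum_mul, Finset.mul_sum]
      rw [Finset.sum_comm]
      exact Finset.sum_congr rfl fun y _ => Finset.sum_congr rfl fun g _ => by ring
    rw [h3, Finset.sum_eq_single y'] at h5
    · rw [inv_mul_cancel] at h5
      exact (mul_eq_zero.1 h5.symm).resolve_right (Phi_one_ne w hw0)
    · intro y _ hy
      rw [orth _ (Y.mul_mem (Y.inv_mem y'.2) y.2), mul_zero]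
      intro e
      exact hy (Subtype.ext (inv_mul_eq_one.1 e).symm)
    · simp
  have := hlin.fintype_card_le_finrank
  rw [Module.finrank_fintype_fun_eq_card] at this
  rw [Subgroup.index_eq_card, Nat.card_eq_fintype_card, Nat.card_eq_fintype_card]
  exact this
end SpIdx

set_option linter.all false
set_option linter.unusedSectionVars false
set_option linter.unusedVariables false
namespace SpIdx
open Matrix

variable {m : ℕ} {F : Type} [Field F] [Fintype F]

/-- unital lower triangular matrices w.r.t. κ -/
def IsLow (κ : Pos m → ℤ) (A : Mt m F) : Prop := ∀ x z, ¬ (κ z < κ x) → A x z = (1 : Mt m F) x z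

theorem IsLow.mul {κ : Pos m → ℤ} {A B : Mt m F} (ha : IsLow κ A) (hb : IsLow κ B) : IsLow κ (A * B) := by
  intro x z h
  have e : (1 : Mt m F) x z = ((1 : Mt m F) * 1) x z := by rw [mul_one]
  rw [e, Matrix.mul_apply, Matrix.mul_apply]
  refine Finset.sum_congr rfl fun y _ => ?_
  by_cases h1 : κ y < κ x
  · have h2 : y ≠ z := by rintro rfl; exact h h1
    rw [hb y z (by omega), Matrix.one_apply_ne h2, mul_zero, mul_zero]
  · rw [ha x y h1]
    by_cases h3 : x = y
    · subst h3; rw [hb x z h]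
    · rw [Matrix.one_apply_ne h3, zero_mul, zero_mul]

def Ylow (F : Type) [Field F] [Fintype F] (κ : Pos m → ℤ) (hκ : ∀ x, κ x.swap = - κ x) : Subgroup (Sp m F) where
  carrier := {g | IsLow κ g.1}
  one_mem' := fun x z _ => rfl
  mul_mem' := fun {a b} ha hb => IsLow.mul (A := a.1) (B := b.1) ha hb
  inv_mem' := by
    intro a ha x z h
    rw [inv_entry, ha _ _ (by rw [hκ, hκ]; omega)]
    by_cases e : x = z
    · subst e; simp [sg_sq]
    · rw [Matrix.one_apply_ne e, Matrix.one_apply_ne (fun e' => e (by simpa using (congrArg Sum.swap e').symm)), mul_zero]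

/-- strictly lower -/
theorem pow_supp (κ : Pos m → ℤ) (n : Mt m F) (hn : ∀ x z, ¬ (κ z < κ x) → n x z = 0) (i : ℕ) :
    ∀ x z, ¬ (κ z + i ≤ κ x) → (n ^ i) x z = 0 := by
  induction i with
  | zero =>
    intro x z h
    have : x ≠ z := by rintro rfl; simp at h
    rw [pow_zero, Matrix.one_apply_ne this]
  | succ i ih =>
    intro x z h
    rw [pow_succ, Matrix.mul_apply]
    refine Finset.sum_eq_zero fun y _ => ?_
    by_cases h1 : κ y + i ≤ κ x
    · rw [hn y z (by push_cast at h; omega), mul_zero]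
    · rw [ih x y h1, zero_mul]

theorem cayley (h2 : (2:F) ≠ 0) (κ : Pos m → ℤ) (hκ : ∀ x, κ x.swap = - κ x) (n : Mt m F)
    (hn : ∀ x z, ¬ (κ z < κ x) → n x z = 0)
    (hs : ∀ x y, om (n *ᵥ x) y + om x (n *ᵥ y) = 0) :
    ∃ c ∈ Ylow F κ hκ, c.1 * (1 - n) = 1 + n := by
  obtain ⟨M, hM0, hM⟩ : ∃ M : ℕ, 1 ≤ M ∧ ∀ x z : Pos m, κ x - κ z < M := by
    refine ⟨1 + ∑ p : Pos m × Pos m, (κ p.1 - κ p.2).natAbs, by omega, fun x z => ?_⟩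
    have := Finset.single_le_sum (f := fun p : Pos m × Pos m => (κ p.1 - κ p.2).natAbs)
      (fun _ _ => Nat.zero_le _) (Finset.mem_univ (x, z))
    simp only at this
    omega
  have hnil : n ^ M = 0 := by
    ext x z
    rw [pow_supp κ n hn M x z (by have := hM x z; omega)]; rfl
  set S : Mt m F := ∑ i ∈ Finset.range M, n ^ i with hS
  have hS1 : (1 - n) * S = 1 := by
    rw [hS, mul_neg_geom_sum, hnil, sub_zero]
  have hS2 : S * (1 - n) = 1 := by
    rw [hS, geom_sum_mul_neg, hnil, sub_zero]
  have hlow : IsLow κ ((1 + n) * S) := by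
    apply IsLow.mul
    · intro x z h
      rw [Matrix.add_apply, hn x z h, add_zero]
    · intro x z h
      rw [hS, Matrix.sum_apply, Finset.sum_eq_single 0]
      · rw [pow_zero]
      · intro i _ hi
        rw [pow_supp κ n hn i x z (by omega)]
      · intro h0; exact absurd (Finset.mem_range.2 (by omega)) h0
  have hsp : (1 + n) * S ∈ symplecticGroup (Fin m) F := by
    rw [mem_Sp_iff]
    intro x y
    have key : ∀ x' y', om ((1 + n) *ᵥ x') ((1 + n) *ᵥ y') = om ((1 - n) *ᵥ x') ((1 - n) *ᵥ y') := by
      intro x' y'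
      simp only [add_mulVec, sub_mulVec, one_mulVec, om_add_left, om_add_right, om_sub_left, om_sub_right]
      linear_combination 2 * hs x' y'
    rw [← mulVec_mulVec, ← mulVec_mulVec, key, mulVec_mulVec, mulVec_mulVec, hS1, one_mulVec, one_mulVec]
  refine ⟨⟨_, hsp⟩, hlow, ?_⟩
  change (1 + n) * S * (1 - n) = 1 + n
  rw [mul_assoc, hS2, mul_one]

/-- admissible pairs -/
def gq (κ o : Pos m → ℤ) : Finset (Pos m × Pos m) :=
  Finset.univ.filter fun p => κ p.1 + κ p.2 < 0 ∧ o p.1 ≤ o p.2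

open Classical in
noncomputable def symf (κ o : Pos m → ℤ) (f : gq κ o → F) (x z : Pos m) : F :=
  if h : (x, z) ∈ gq κ o then f ⟨_, h⟩ else if h : (z, x) ∈ gq κ o then f ⟨_, h⟩ else 0

theorem symf_symm (κ o : Pos m → ℤ) (ho : Function.Injective o) (f : gq κ o → F) (x z : Pos m) :
    symf κ o f x z = symf κ o f z x := by
  unfold symf
  by_cases h1 : (x, z) ∈ gq κ o
  · by_cases h2 : (z, x) ∈ gq κ o
    · have : x = z := by
        simp only [gq, Finset.mem_filter] at h1 h2
        exact ho (by omega)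
      subst this; rfl
    · simp [h1, h2]
  · by_cases h2 : (z, x) ∈ gq κ o
    · simp [h1, h2]
    · simp [h1, h2]

theorem symf_supp (κ o : Pos m → ℤ) (f : gq κ o → F) (x z : Pos m) (h : ¬ (κ x + κ z < 0)) :
    symf κ o f x z = 0 := by
  unfold symf
  rw [dif_neg, dif_neg]
  · simp only [gq, Finset.mem_filter]; omega
  · simp only [gq, Finset.mem_filter]; omega

theorem Ylow_card (h2 : (2:F) ≠ 0) (κ o : Pos m → ℤ) (hκ : ∀ x, κ x.swap = - κ x)
    (ho : Function.Injective o) : Fintype.card F ^ (gq κ o).card ≤ Nat.card (Ylow F κ hκ) := by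
  classical
  let nn : (gq κ o → F) → Mt m F := fun f => Matrix.of fun x z => - sg F x * symf κ o f x.swap z
  have hnn : ∀ f x z, nn f x z = - sg F x * symf κ o f x.swap z := fun f x z => rfl
  have hsup : ∀ f x z, ¬ (κ z < κ x) → nn f x z = 0 := by
    intro f x z h
    rw [hnn, symf_supp κ o f _ _ (by rw [hκ]; omega), mul_zero]
  have hskew : ∀ f x y, om (nn f *ᵥ x) y + om x (nn f *ᵥ y) = 0 := by
    intro f x y
    have e1 : om (nn f *ᵥ x) y = - ∑ z, ∑ t, symf κ o f z t * x t * y z := by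
      rw [om_eq, ← Finset.sum_neg_distrib]
      refine Fintype.sum_equiv (Equiv.sumComm _ _) _ _ fun z => ?_
      change _ = - ∑ t, symf κ o f z.swap t * x t * y z.swap
      simp only [mulVec, dotProduct]
      rw [Finset.mul_sum, Finset.sum_mul, ← Finset.sum_neg_distrib]
      refine Finset.sum_congr rfl fun t _ => ?_
      rw [hnn]
      have := sg_sq (F := F) z
      linear_combination (- symf κ o f z.swap t * x t * y z.swap) * this
    have e2 : om x (nn f *ᵥ y) = ∑ z, ∑ t, symf κ o f z t * x z * y t := by
      rw [om_eq]
      refine Finset.sum_congr rfl fun z _ => ?_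
      simp only [mulVec, dotProduct]
      rw [Finset.mul_sum]
      refine Finset.sum_congr rfl fun t _ => ?_
      rw [hnn, Sum.swap_swap, sg_swap]
      have := sg_sq (F := F) z
      linear_combination (symf κ o f z t * x z * y t) * this
    rw [e1, e2, Finset.sum_comm, neg_add_eq_zero]
    refine Finset.sum_congr rfl fun z _ => Finset.sum_congr rfl fun t _ => ?_
    rw [symf_symm κ o ho]
  choose c hc hc' using fun f => cayley h2 κ hκ (nn f) (hsup f) (hskew f)
  have hinj : Function.Injective fun f => (⟨c f, hc f⟩ : Ylow F κ hκ) := by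
    intro f f' e
    have e1 : c f = c f' := congrArg Subtype.val e
    have inv : ∀ f, ((c f).1 + 1) * (1 - nn f) = (2:F) • 1 := by
      intro f
      rw [add_mul, hc', one_mul, two_smul]; abel
    have e3 : nn f = nn f' := by
      have i1 := inv f
      have i2 := inv f'
      rw [← e1] at i2
      have l : ((2:F)⁻¹ • (1 - nn f)) * ((c f).1 + 1) = 1 := by
        rw [mul_eq_one_comm, Matrix.mul_smul, i1, smul_smul, inv_mul_cancel₀ h2, one_smul]
      have : (1 - nn f) = 1 - nn f' := by
        have g1 := congrArg (fun A => ((2:F)⁻¹ • (1 - nn f)) * A) (i1.trans i2.symm)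
        simp only [← mul_assoc] at g1
        rwa [l, one_mul, one_mul] at g1
      exact sub_right_injective this
    funext p
    obtain ⟨⟨x, z⟩, hp⟩ := p
    have e4 := congrFun (congrFun e3 x.swap) z
    rw [hnn, hnn, Sum.swap_swap] at e4
    have e5 := mul_left_cancel₀ (neg_ne_zero.2 (sg_ne _)) e4
    unfold symf at e5
    simpa [hp] using e5
  have := Nat.card_le_card_of_injective _ hinj
  rwa [Nat.card_eq_fintype_card, Fintype.card_fun, Fintype.card_coe] at this

/-- number of distinct negative values -/
def negv (κ : Pos m → ℤ) : Finset ℤ := (Finset.univ.image κ).filter (· < 0)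

theorem gq_card (κ o : Pos m → ℤ) (hκ : ∀ x, κ x.swap = - κ x) (ho : Function.Injective o) :
    m * (negv κ).card ≤ (gq κ o).card := by
  classical
  set P : Finset (Pos m × Pos m) := Finset.univ.filter fun p => κ p.1 + κ p.2 < 0 with hP
  set D : Finset (Pos m) := Finset.univ.filter fun x => κ x < 0 with hD
  have A : (negv κ).card * (2 * m) ≤ P.card + D.card := by
    have hx : ∀ c : negv κ, ∃ x, κ x = c.1 := by
      intro c
      have := c.2
      simp only [negv, Finset.mem_filter, Finset.mem_image] at this
      obtain ⟨⟨x, -, hx⟩, -⟩ := this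
      exact ⟨x, hx⟩
    have hneg : ∀ c : negv κ, c.1 < 0 := fun c => (Finset.mem_filter.1 c.2).2
    choose X hX using hx
    let Φ : negv κ × Pos m → P ⊕ D := fun p =>
      if h : κ p.2 < - p.1.1 then Sum.inl ⟨(X p.1, p.2), by simp [hP, hX]; omega⟩
      else if h' : - p.1.1 < κ p.2 then Sum.inl ⟨((X p.1).swap, p.2.swap), by simp [hP, hX, hκ]; omega⟩
      else Sum.inr ⟨p.2.swap, by simp only [hD, Finset.mem_filter, Finset.mem_univ, true_and]; rw [hκ]; have := hneg p.1; omega⟩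
    have hΦ : Function.Injective Φ := by
      rintro ⟨c, z⟩ ⟨c', z'⟩ e
      have n1 := hneg c
      have n2 := hneg c'
      have x1 := hX c
      have x2 := hX c'
      have s1 := hκ (X c)
      have s2 := hκ (X c')
      simp only [Φ] at e
      split_ifs at e with h1 h2 h3 h4 h5 h6 h7 h8
      all_goals first
        | (simp only [Sum.inl.injEq, Subtype.mk.injEq, Prod.mk.injEq] at e
           obtain ⟨e1, e2⟩ := e
           have e3 := congrArg κ e1
           first
             | (exfalso; omega)
             | (have e4 : c = c' := Subtype.ext (by omega)
                have e5 : z = z' := by first | exact e2 | simpa using congrArg Sum.swap e2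
                rw [e4, e5]))
        | (simp only [Sum.inr.injEq, Subtype.mk.injEq] at e
           have e5 : z = z' := by simpa using congrArg Sum.swap e
           subst e5
           have e4 : c = c' := Subtype.ext (by omega)
           rw [e4])
        | cases e
    have := Fintype.card_le_of_injective _ hΦ
    simp only [Fintype.card_prod, Fintype.card_sum, Fintype.card_coe, Fintype.card_fin] at this
    calc _ = (negv κ).card * (m + m) := by ring
      _ ≤ _ := this
  have B1 : P.card ≤ (gq κ o).card + (P.filter fun p => o p.2 < o p.1).card := by
    rw [← Finset.card_filter_add_card_filter_not (s := P) (fun p => o p.1 ≤ o p.2)]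
    refine Nat.add_le_add (Finset.card_le_card ?_) (Finset.card_le_card ?_)
    · intro p hp
      simp only [hP, gq, Finset.mem_filter, Finset.mem_univ, true_and] at hp ⊢
      exact hp
    · intro p hp
      simp only [Finset.mem_filter, not_le] at hp ⊢
      exact hp
  have B2 : (P.filter fun p => o p.2 < o p.1).card + D.card ≤ (gq κ o).card := by
    rw [← Finset.card_map (Equiv.prodComm (Pos m) (Pos m)).toEmbedding,
      ← Finset.card_map (f := ⟨fun x : Pos m => (x, x), fun x y h => (Prod.mk.inj h).1⟩) (s := D),
      ← Finset.card_union_of_disjoint]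
    · refine Finset.card_le_card ?_
      rintro ⟨x, z⟩ hp
      simp only [Finset.mem_union, Finset.mem_map, hP, hD, gq, Finset.mem_filter, Finset.mem_univ, true_and] at hp ⊢
      rcases hp with ⟨⟨a, b⟩, h, e⟩ | ⟨a, h, e⟩
      · have e1 : b = x := congrArg Prod.fst e
        have e2 : a = z := congrArg Prod.snd e
        subst e1 e2; simp only at h; omega
      · have e1 : a = x := congrArg Prod.fst e
        have e2 : a = z := congrArg Prod.snd e
        subst e1; subst e2; omega
    · rw [Finset.disjoint_left]
      rintro ⟨x, z⟩ h1 h2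
      simp only [Finset.mem_map, Finset.mem_filter] at h1 h2
      obtain ⟨⟨a, b⟩, h, e⟩ := h1
      obtain ⟨c, -, e'⟩ := h2
      have e1 : b = x := congrArg Prod.fst e
      have e2 : a = z := congrArg Prod.snd e
      have e3 : c = x := congrArg Prod.fst e'
      have e4 : c = z := congrArg Prod.snd e'
      have : a = b := by rw [e1, e2, ← e3, ← e4]
      subst this
      exact absurd h.2 (lt_irrefl _)
  have : (negv κ).card * (2 * m) ≤ 2 * (gq κ o).card := by omega
  nlinarith
end SpIdx

set_option linter.all false
set_option linter.unusedSectionVars false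
set_option linter.unusedVariables false
namespace SpIdx
open Matrix

variable {m : ℕ} {F : Type} [Field F] [Fintype F]

def posK (m : ℕ) : Key m where
  k := Sum.elim (fun i => (i : ℤ) - m) (fun i => m - (i : ℤ))
  odd := by rintro (i | i) <;> simp
  inj := by
    rintro (i | i) (j | j) h <;> simp at h
    · rw [Fin.ext h]
    · have := i.2; have := j.2; omega
    · have := i.2; have := j.2; omega
    · rw [Fin.ext h]

theorem posK_abs (x : Pos m) : |(posK m).k x| ≤ m := by
  rw [abs_le]
  rcases x with i | i <;> simp [posK] <;> have := i.2 <;> omega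

/-- an injection of the characters into the naturals -/
noncomputable def nu (F : Type) [Field F] [Fintype F] : MulChar F ℂ → ℕ :=
  (Countable.exists_injective_nat (MulChar F ℂ)).choose
theorem nu_inj : Function.Injective (nu F) := (Countable.exists_injective_nat (MulChar F ℂ)).choose_spec

noncomputable def kap (φ : MulChar F ℂ) : ℤ :=
  if nu F φ < nu F φ⁻¹ then -((nu F φ : ℤ) + 1) else if nu F φ⁻¹ < nu F φ then (nu F φ⁻¹ : ℤ) + 1 else 0

theorem kap_inv (φ : MulChar F ℂ) : kap φ⁻¹ = - kap φ := by
  unfold kap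
  rw [inv_inv]
  split_ifs <;> first | omega | rfl | simp

theorem kap_neg_inj {φ ψ : MulChar F ℂ} (h : kap φ = kap ψ) (h0 : kap φ < 0) : φ = ψ := by
  apply nu_inj
  unfold kap at h h0
  split_ifs at h h0 <;> omega

theorem kap_zero {φ : MulChar F ℂ} (h : kap φ = 0) : φ⁻¹ = φ := by
  apply nu_inj
  unfold kap at h
  split_ifs at h <;> omega

noncomputable def kp (θ : Wt m F) (x : Pos m) : ℤ := kap (θ.t x)

theorem kp_odd (θ : Wt m F) (x : Pos m) : kp θ x.swap = - kp θ x := by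
  unfold kp; rw [θ.odd, kap_inv]

theorem lex_aux {a b p q : ℤ} {M : ℤ} (hp : |p| ≤ M) (hq : |q| ≤ M) (h : a < b) :
    a * (2 * M + 1) + p < b * (2 * M + 1) + q := by
  rw [abs_le] at hp hq
  nlinarith

noncomputable def sortK (θ : Wt m F) : Key m where
  k x := kp θ x * (2 * m + 1) + (posK m).k x
  odd x := by rw [kp_odd, (posK m).odd]; ring
  inj := by
    intro x z h
    simp only at h
    rcases lt_trichotomy (kp θ x) (kp θ z) with h1 | h1 | h1
    · have := lex_aux (posK_abs x) (posK_abs z) h1; omega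
    · rw [h1] at h
      exact (posK m).inj (by omega)
    · have := lex_aux (posK_abs z) (posK_abs x) h1; omega

theorem sortK_lt (θ : Wt m F) {x z : Pos m} (h : kp θ x < kp θ z) : (sortK θ).k x < (sortK θ).k z :=
  lex_aux (posK_abs x) (posK_abs z) h

theorem eig_bound (h2 : (2:F) ≠ 0) (θ : Wt m F) (H : Subgroup (Sp m F)) (χ w : Sp m F → ℂ)
    (hw : IsEig (posK m) θ w) (hw0 : w ≠ 0) (hl : IsLeft H χ w) :
    Fintype.card F ^ (m * (negv (kp θ)).card) ≤ H.index := by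
  obtain ⟨w', h0, he, hl'⟩ := resort h2 (posK m) (sortK θ) θ H χ w hw hw0 hl (by
    intro x z e h
    have : kp θ x = kp θ z := by unfold kp; rw [e]
    simp only [sortK]; rw [this]; omega)
  have h1 := index_ge h2 (sortK θ) θ H χ w' he h0 hl' (Ylow F (kp θ) (kp_odd θ)) (by
    intro y hy hb
    apply Subtype.ext
    ext x z
    by_cases h : kp θ z < kp θ x
    · have : x ≠ z := by rintro rfl; omega
      rw [hb x z (sortK_lt θ h)]
      exact (Matrix.one_apply_ne this).symm
    · exact hy x z h) (by
    intro y hy j k hjk hne e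
    have : kp θ j = kp θ k := by unfold kp; rw [e]
    have hjk' : j ≠ k := by rintro rfl; omega
    apply hne
    rw [hy j k (by omega), Matrix.one_apply_ne hjk'])
  have h3 := Ylow_card h2 (kp θ) (posK m).k (kp_odd θ) (posK m).inj
  have h4 := gq_card (kp θ) (posK m).k (kp_odd θ) (posK m).inj
  exact (Nat.pow_le_pow_right Fintype.card_pos h4).trans (h3.trans h1)

theorem ext_char {G : Type*} [Group G] [Finite G] (N : Subgroup G) (hN : N.Normal)
    (hab : ∀ a b : G, a * b * a⁻¹ * b⁻¹ ∈ N) (D : Subgroup G) (ψ : D →* ℂˣ)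
    (h : ∀ d : D, d.1 ∈ N → ψ d = 1) : ∃ χ : G →* ℂˣ, (∀ n ∈ N, χ n = 1) ∧ ∀ d : D, χ d.1 = ψ d := by
  let _i : CommGroup (G ⧸ N) := { (inferInstance : Group (G ⧸ N)) with
    mul_comm := by
      intro a b
      obtain ⟨a, rfl⟩ := QuotientGroup.mk_surjective a
      obtain ⟨b, rfl⟩ := QuotientGroup.mk_surjective b
      rw [← QuotientGroup.mk_mul, ← QuotientGroup.mk_mul, QuotientGroup.eq]
      have := hab b⁻¹ a⁻¹
      simpa [mul_assoc] using this }
  let f : G →* G ⧸ N := QuotientGroup.mk' N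
  have hs := f.subgroupMap_surjective D
  let ψ' : D.map f →* ℂˣ := (f.subgroupMap D).liftOfSurjective hs ⟨ψ, by
    intro d hd
    rw [MonoidHom.mem_ker] at hd ⊢
    apply h
    have : f d.1 = 1 := congrArg Subtype.val hd
    exact (QuotientGroup.eq_one_iff _).1 this⟩
  obtain ⟨χ, hχ⟩ := MonoidHom.domRestrict_surjective ℂ (D.map f) ψ'
  refine ⟨χ.comp f, fun n hn => ?_, fun d => ?_⟩
  · have : f n = 1 := (QuotientGroup.eq_one_iff n).2 hn
    rw [MonoidHom.comp_apply, this, map_one]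
  · have e1 : χ (f d.1) = ψ' (f.subgroupMap D d) := by
      rw [← hχ]; rfl
    rw [MonoidHom.comp_apply, e1]
    exact MonoidHom.liftOfRightInverse_comp_apply _ _ _ _ _

theorem ev_ne (θ : Wt m F) {K : Key m} {b : Sp m F} (hb : b ∈ Bor F K) : ev θ b ≠ 0 := by
  intro h
  have := ev_mul θ hb ((Bor F K).inv_mem hb)
  rw [mul_inv_cancel, ev_one, h, zero_mul] at this
  exact one_ne_zero this

theorem rank_bound (h2 : (2:F) ≠ 0) (H : Subgroup (Sp m F)) (N : Subgroup H) (hN : N.Normal)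
    (hab : ∀ a b : H, a * b * a⁻¹ * b⁻¹ ∈ N) (θ : Wt m F)
    (hθ : ∀ h : H, h.1 ∈ Bor F (posK m) → h ∈ N → ev θ h.1 = 1) :
    Fintype.card F ^ (m * (negv (kp θ)).card) ≤ H.index := by
  classical
  let D : Subgroup H := (Bor F (posK m)).comap H.subtype
  have hD : ∀ d : D, d.1.1 ∈ Bor F (posK m) := fun d => d.2
  let ψ : D →* ℂˣ := 
    { toFun := fun d => Units.mk0 (ev θ d.1.1) (ev_ne θ (hD d))
      map_one' := by ext; exact ev_one θ
      map_mul' := by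
        intro a b
        ext
        exact ev_mul θ (hD a) (hD b) }
  obtain ⟨χ, -, hχ⟩ := ext_char N hN hab D ψ (by
    intro d hd
    ext
    exact hθ d.1 (hD d) hd)
  have hχ' : ∀ h : H, h.1 ∈ Bor F (posK m) → (χ h : ℂ) = ev θ h.1 := by
    intro h hh
    exact congrArg Units.val (hχ ⟨h, hh⟩)
  let X : Sp m F → ℂ := fun g => if hg : g ∈ H then (χ ⟨g, hg⟩ : ℂ) else 0
  have hX : ∀ h ∈ H, ∀ g, X (h * g) = X h * X g := by
    intro h hh g
    by_cases hg : g ∈ H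
    · simp only [X, hg, hh, H.mul_mem hh hg, dif_pos]
      rw [← Units.val_mul, ← map_mul]; rfl
    · have : h * g ∉ H := fun h' => hg ((H.mul_mem_cancel_left hh).1 h')
      simp [X, hg, this]
  let B : Finset (Sp m F) := Finset.univ.filter (· ∈ Bor F (posK m))
  let w : Sp m F → ℂ := fun g => ∑ b ∈ B, X (g * b⁻¹) * ev θ b
  refine eig_bound h2 θ H X w ?_ ?_ ?_
  · intro g b hb
    simp only [w]
    rw [Finset.mul_sum]
    refine Finset.sum_equiv (Equiv.mulRight b⁻¹) ?_ ?_
    · intro c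
      simp only [B, Finset.mem_filter, Finset.mem_univ, true_and, Equiv.coe_mulRight]
      exact ((Bor F (posK m)).mul_mem_cancel_right ((Bor F (posK m)).inv_mem hb)).symm
    · intro c hc
      have hc' : c ∈ Bor F (posK m) := by simpa [B] using hc
      simp only [Equiv.coe_mulRight]
      have e : ev θ c = ev θ (c * b⁻¹) * ev θ b := by
        rw [← ev_mul θ ((Bor F (posK m)).mul_mem hc' ((Bor F (posK m)).inv_mem hb)) hb]
        congr 1; group
      rw [e]
      have e' : g * (c * b⁻¹)⁻¹ = g * b * c⁻¹ := by group
      rw [e']; ring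
  · intro h0
    have e := congrFun h0 1
    simp only [w, Pi.zero_apply] at e
    have e1 : ∀ b ∈ B, X (1 * b⁻¹) * ev θ b = if b ∈ H then 1 else 0 := by
      intro b hb
      have hb' : b ∈ Bor F (posK m) := by simpa [B] using hb
      rw [one_mul]
      split_ifs with h
      · have hi : b⁻¹ ∈ H := H.inv_mem h
        simp only [X, hi, dif_pos]
        rw [← hχ' ⟨b, h⟩ hb', ← Units.val_mul, ← map_mul]
        have : (⟨b⁻¹, hi⟩ : H) * ⟨b, h⟩ = 1 := Subtype.ext (inv_mul_cancel b)
        rw [this, map_one]; rfl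
      · have hi : b⁻¹ ∉ H := fun h' => h (by simpa using h')
        simp [X, h]
    rw [Finset.sum_congr rfl e1, Finset.sum_boole, Nat.cast_eq_zero, Finset.card_eq_zero] at e
    have : (1 : Sp m F) ∈ B.filter (· ∈ H) := by
      simp [B, H.one_mem, (Bor F (posK m)).one_mem]
    rw [e] at this; simp at this
  · intro h hh g
    simp only [w]
    rw [Finset.mul_sum]
    refine Finset.sum_congr rfl fun b _ => ?_
    rw [mul_assoc h, hX h hh, mul_assoc]
end SpIdx

set_option linter.all false
set_option linter.unusedSectionVars false
set_option linter.unusedVariables false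
namespace SpIdx
open Matrix

variable {m : ℕ} {F : Type} [Field F] [Fintype F]

noncomputable def wt (φ : Fin m → MulChar F ℂ) : Wt m F where
  t := Sum.elim φ (fun i => (φ i)⁻¹)
  odd := by rintro (i | i) <;> simp

theorem negv_card_le (φ : Fin m → MulChar F ℂ) : (negv (kp (wt φ))).card ≤ m := by
  classical
  have : negv (kp (wt φ)) ⊆ Finset.univ.image fun i : Fin m => - |kap (φ i)| := by
    intro c hc
    simp only [negv, Finset.mem_filter, Finset.mem_image, Finset.mem_univ, true_and] at hc ⊢
    obtain ⟨⟨x, hx⟩, hc0⟩ := hc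
    rcases x with i | i
    · refine ⟨i, ?_⟩
      have hx : kap (φ i) = c := hx
      rw [hx, abs_of_neg hc0]; ring
    · refine ⟨i, ?_⟩
      have hx : kap (φ i)⁻¹ = c := hx
      rw [kap_inv] at hx
      rw [abs_of_pos (by omega)]; omega
  exact (Finset.card_le_card this).trans (Finset.card_image_le.trans (by simp))

theorem card_invol : Nat.card {φ : MulChar F ℂ // φ⁻¹ = φ} ≤ 2 := by
  classical
  obtain ⟨g, hg⟩ := IsCyclic.exists_generator (α := Fˣ)
  have hv : ∀ φ : {φ : MulChar F ℂ // φ⁻¹ = φ}, φ.1 g = 1 ∨ φ.1 g = -1 := by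
    rintro ⟨φ, h⟩
    have h1 : φ⁻¹ g * φ g = 1 := by
      rw [← MulChar.mul_apply, inv_mul_cancel, MulChar.one_apply_coe]
    rw [h] at h1
    exact mul_self_eq_one_iff.1 h1
  let f : {φ : MulChar F ℂ // φ⁻¹ = φ} → Bool := fun φ => decide (φ.1 g = 1)
  have hf : Function.Injective f := by
    intro φ ψ h
    apply Subtype.ext
    have h1 : φ.1 g = ψ.1 g := by
      have hd : (φ.1 g = 1 ↔ ψ.1 g = 1) := by simpa [f] using h
      rcases hv φ with h1 | h1 <;> rcases hv ψ with h3 | h3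
      · rw [h1, h3]
      · rw [h1, hd.1 h1]
      · rw [hd.2 h3, h3]
      · rw [h1, h3]
    apply MulChar.ext
    intro a
    obtain ⟨k, hk⟩ := Subgroup.mem_zpowers_iff.1 (hg a)
    rw [← MulChar.coe_equivToUnitHom, ← MulChar.coe_equivToUnitHom, ← hk, map_zpow, map_zpow]
    congr 2
    ext
    rw [MulChar.coe_equivToUnitHom, MulChar.coe_equivToUnitHom]
    exact h1
  have := Nat.card_le_card_of_injective f hf
  simpa using this

theorem card_mulChar_le : Nat.card (MulChar F ℂ) ≤ Fintype.card F := by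
  rw [MulChar.card_eq_card_units_of_hasEnoughRootsOfUnity, ← Nat.card_eq_fintype_card]
  exact Nat.card_le_card_of_injective (fun u : Fˣ => (u : F)) (fun a b h => Units.ext h)

theorem cover {α : Type*} [Inhabited α] (s : Finset α) (R : ℕ) (h : s.card ≤ R) :
    ∃ c : Fin R → α, ∀ a ∈ s, ∃ j, c j = a := by
  refine ⟨fun j => if hj : j.1 < s.card then (s.equivFin.symm ⟨j.1, hj⟩).1 else default, fun a ha => ?_⟩
  have := (s.equivFin ⟨a, ha⟩).2
  refine ⟨⟨s.equivFin ⟨a, ha⟩, by omega⟩, ?_⟩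
  simp

theorem count_rank (T : Set (Fin m → MulChar F ℂ)) (R : ℕ) (hR : R ≤ m)
    (hT : ∀ φ ∈ T, (negv (kp (wt φ))).card ≤ R) :
    Nat.card T ≤ (2 * m + 2) ^ m * Fintype.card F ^ R := by
  classical
  let I := {φ : MulChar F ℂ // φ⁻¹ = φ}
  let dec : (Fin R → MulChar F ℂ) × (Fin m → (Fin R ⊕ Fin R) ⊕ I) → (Fin m → MulChar F ℂ) :=
    fun p i => Sum.elim (Sum.elim p.1 (fun j => (p.1 j)⁻¹)) Subtype.val (p.2 i)
  have hsurj : ∀ φ : T, ∃ p, dec p = φ.1 := by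
    rintro ⟨φ, hφ⟩
    obtain ⟨c, hc⟩ := cover (negv (kp (wt φ))) R (hT φ hφ)
    let k2c : ℤ → MulChar F ℂ := fun v => if h : ∃ ψ : MulChar F ℂ, kap ψ = v then h.choose else 1
    have hk2c : ∀ ψ : MulChar F ℂ, kap ψ < 0 → k2c (kap ψ) = ψ := by
      intro ψ hψ
      have h : ∃ ψ' : MulChar F ℂ, kap ψ' = kap ψ := ⟨ψ, rfl⟩
      simp only [k2c, dif_pos h]
      exact kap_neg_inj h.choose_spec (by rw [h.choose_spec]; exact hψ)
    have hcode : ∀ i, ∃ d : (Fin R ⊕ Fin R) ⊕ I,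
        Sum.elim (Sum.elim (k2c ∘ c) (fun j => ((k2c ∘ c) j)⁻¹)) Subtype.val d = φ i := by
      intro i
      rcases lt_trichotomy (kap (φ i)) 0 with h | h | h
      · obtain ⟨j, hj⟩ := hc (kap (φ i)) (by
          simp only [negv, Finset.mem_filter, Finset.mem_image, Finset.mem_univ, true_and]
          exact ⟨⟨Sum.inl i, rfl⟩, h⟩)
        exact ⟨Sum.inl (Sum.inl j), by simp [hj, hk2c _ h]⟩
      · exact ⟨Sum.inr ⟨φ i, kap_zero h⟩, rfl⟩
      · have h' : kap (φ i)⁻¹ < 0 := by rw [kap_inv]; omega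
        obtain ⟨j, hj⟩ := hc (kap (φ i)⁻¹) (by
          simp only [negv, Finset.mem_filter, Finset.mem_image, Finset.mem_univ, true_and]
          exact ⟨⟨Sum.inr i, rfl⟩, h'⟩)
        exact ⟨Sum.inl (Sum.inr j), by simp [hj, hk2c _ h']⟩
    choose d hd using hcode
    exact ⟨(k2c ∘ c, d), funext hd⟩
  choose enc henc using hsurj
  have hinj : Function.Injective enc := fun a b h => Subtype.ext (by rw [← henc, ← henc, h])
  have h1 := Nat.card_le_card_of_injective enc hinj
  rw [Nat.card_prod, Nat.card_fun, Nat.card_fun, Nat.card_sum, Nat.card_sum] at h1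
  simp only [Nat.card_eq_fintype_card (α := Fin _), Fintype.card_fin] at h1
  refine h1.trans ?_
  rw [mul_comm]
  have h3 : Nat.card I ≤ 2 := card_invol (F := F)
  exact Nat.mul_le_mul (Nat.pow_le_pow_left (by omega) _) (Nat.pow_le_pow_left card_mulChar_le _)

/-- diagonal homomorphism -/
noncomputable def dg (K : Key m) : Bor F K →* (Fin m → Fˣ) where
  toFun b i := Units.mk0 (b.1.1 (Sum.inl i) (Sum.inl i)) (Bor_diag_ne b.2 _)
  map_one' := by
    funext i; ext
    change (1 : Mt m F) _ _ = 1
    simp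
  map_mul' a b := by
    funext i; ext
    exact Bor_diag_mul a.2 b.2 _

theorem dual_bound (h2 : (2:F) ≠ 0) (H : Subgroup (Sp m F)) (N : Subgroup H) (hN : N.Normal)
    (hab : ∀ a b : H, a * b * a⁻¹ * b⁻¹ ∈ N) :
    ((Fintype.card F - 1) ^ m) ^ m ≤
      (Nat.card (((N.map H.subtype).subgroupOf (Bor F (posK m))).map (dg (posK m)))) ^ m *
        ((2 * m + 2) ^ (m * m) * H.index) := by
  classical
  set S := ((N.map H.subtype).subgroupOf (Bor F (posK m))).map (dg (posK m)) with hS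
  set T : Set (Fin m → MulChar F ℂ) :=
    {φ | ∀ h : H, h.1 ∈ Bor F (posK m) → h ∈ N → ev (wt φ) h.1 = 1} with hT
  have hev1 : ∀ h : Sp m F, h ∈ Bor F (posK m) → ev (wt (1 : Fin m → MulChar F ℂ)) h = 1 := by
    intro h hh
    unfold ev
    refine Finset.prod_eq_one fun i _ => ?_
    exact MulChar.one_apply (isUnit_iff_ne_zero.2 (Bor_diag_ne hh _))
  have h1T : (1 : Fin m → MulChar F ℂ) ∈ T := fun h hh _ => hev1 _ hh
  -- part 1
  have p1 : (Nat.card T) ^ m ≤ (2 * m + 2) ^ (m * m) * H.index := by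
    obtain ⟨φ, hφ, hmax⟩ := Set.exists_max_image T (fun φ => (negv (kp (wt φ))).card) (Set.toFinite _) ⟨_, h1T⟩
    have c1 := count_rank T _ (negv_card_le φ) hmax
    have c2 := rank_bound h2 H N hN hab (wt φ) hφ
    calc (Nat.card T) ^ m ≤ ((2 * m + 2) ^ m * Fintype.card F ^ (negv (kp (wt φ))).card) ^ m :=
          Nat.pow_le_pow_left c1 _
      _ = (2 * m + 2) ^ (m * m) * Fintype.card F ^ (m * (negv (kp (wt φ))).card) := by
          rw [mul_pow, ← pow_mul, ← pow_mul, mul_comm m (negv _).card]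
      _ ≤ _ := Nat.mul_le_mul_left _ c2
  -- part 2
  have p2 : (Fintype.card F - 1) ^ m ≤ Nat.card S * Nat.card T := by
    have e1 : Nat.card (Fin m → Fˣ) = (Fintype.card F - 1) ^ m := by
      rw [Nat.card_fun, Nat.card_units, Nat.card_eq_fintype_card, Nat.card_eq_fintype_card, Fintype.card_fin]
    have e2 := CommGroup.card_domRestrictHom_ker ℂ S
    have e3 := Subgroup.card_eq_card_quotient_mul_card_subgroup S
    rw [← e1, e3, ← e2, mul_comm]
    refine Nat.mul_le_mul_left _ ?_
    let f : (MonoidHom.domRestrictHom S ℂˣ).ker → T := fun χ =>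
      ⟨fun i => MulChar.ofUnitHom (χ.1.comp (MonoidHom.mulSingle (fun _ : Fin m => Fˣ) i)), by
        intro h hh hn
        have e4 : ev (wt fun i => MulChar.ofUnitHom (χ.1.comp (MonoidHom.mulSingle (fun _ : Fin m => Fˣ) i))) h.1
            = ((χ.1 (dg (posK m) ⟨h.1, hh⟩) : ℂˣ) : ℂ) := by
          rw [← Finset.univ_prod_mulSingle (dg (posK m) ⟨h.1, hh⟩), map_prod, Units.coe_prod]
          unfold ev
          refine Finset.prod_congr rfl fun i _ => ?_
          exact MulChar.ofUnitHom_coe _ (dg (posK m) ⟨h.1, hh⟩ i)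
        rw [e4]
        have e5 : dg (posK m) ⟨h.1, hh⟩ ∈ S := by
          refine ⟨⟨h.1, hh⟩, ?_, rfl⟩
          exact ⟨h, hn, rfl⟩
        have e6 := DFunLike.congr_fun (MonoidHom.mem_ker.1 χ.2) ⟨_, e5⟩
        have e7 : χ.1 (dg (posK m) ⟨h.1, hh⟩) = 1 := e6
        rw [e7]; rfl⟩
    have hf : Function.Injective f := by
      intro χ χ' e
      apply Subtype.ext
      have e' := congrArg Subtype.val e
      refine MonoidHom.ext fun d => ?_
      rw [← Finset.univ_prod_mulSingle d, map_prod, map_prod]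
      refine Finset.prod_congr rfl fun i _ => ?_
      have e4 := congrFun e' i
      have e5 := congrArg (fun ψ : MulChar F ℂ => ψ (d i : F)) e4
      simp only [f, MulChar.ofUnitHom_coe] at e5
      exact Units.ext e5
    exact Nat.card_le_card_of_injective f hf
  calc _ ≤ (Nat.card S * Nat.card T) ^ m := Nat.pow_le_pow_left p2 _
    _ = (Nat.card S) ^ m * (Nat.card T) ^ m := mul_pow _ _ _
    _ ≤ _ := Nat.mul_le_mul_left _ p1
end SpIdx

set_option linter.all false
set_option linter.unusedSectionVars false
set_option linter.unusedVariables false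
namespace SpIdx
open Matrix

variable {m : ℕ} {F : Type} [Field F] [Fintype F]

/-- Symmetric unipotent attached to two orthogonal vectors -/
def shr (a b : Pos m → F) : (Pos m → F) →ₗ[F] (Pos m → F) where
  toFun y := y + (om y a) • b + (om y b) • a
  map_add' x y := by
    rw [om_add_left, om_add_left]; module
  map_smul' c y := by
    rw [om_smul_left, om_smul_left, RingHom.id_apply]; module

theorem shr_mem (h2 : (2:F) ≠ 0) (a b : Pos m → F) (h : om a b = 0) :
    LinearMap.toMatrix' (shr a b) ∈ symplecticGroup (Fin m) F := by
  rw [mem_Sp_iff]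
  intro x y
  rw [mat_of_lin, mat_of_lin]
  simp only [shr, LinearMap.coe_mk, AddHom.coe_mk, om_add_left, om_add_right, om_smul_left,
    om_smul_right, om_self h2, h, om_swap b a, om_swap b y, om_swap a y]
  ring

def shrS (h2 : (2:F) ≠ 0) (a b : Pos m → F) (h : om a b = 0) : Sp m F := ⟨_, shr_mem h2 a b h⟩

theorem shrS_mulVec (h2 : (2:F) ≠ 0) (a b : Pos m → F) (h : om a b = 0) (y : Pos m → F) :
    (shrS h2 a b h).1 *ᵥ y = y + (om y a) • b + (om y b) • a := mat_of_lin _ _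

theorem fixed_unique (h2 : (2:F) ≠ 0) (K : Key m) (g : Sp m F)
    (h : ∀ u ∈ Uni F K, g⁻¹ * u * g ∈ Bor F K) : g ∈ Bor F K := by
  by_contra hg
  obtain ⟨j, k, hkj, hne, -, hrow, hrow'⟩ := exists_pivot K g hg
  have hjk : j ≠ k := by rintro rfl; omega
  have hjs : j ≠ j.swap := by rcases j with i | i <;> simp
  have hab : om (bv j.swap : Pos m → F) (bv k) = 0 := by
    rw [om_bv_left, Sum.swap_swap]; simp [bv, hjk]
  set u := shrS h2 (bv j.swap) (bv k) hab with hu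
  have ent : ∀ r s, u.1 r s = (1 : Mt m F) r s + (sg F s * (bv j.swap : Pos m → F) s.swap) * (bv k : Pos m → F) r
      + (sg F s * (bv k : Pos m → F) s.swap) * (bv j.swap : Pos m → F) r := by
    intro r s
    rw [entry u.1 r s, hu, shrS_mulVec, om_bv_left, om_bv_left]
    simp only [Pi.add_apply, Pi.smul_apply, smul_eq_mul, Matrix.one_apply, Pi.single_apply]
  have hz1 : ∀ r s, ¬ (K.k r < K.k s) → (bv j.swap : Pos m → F) s.swap * (bv k : Pos m → F) r = 0 := by
    intro r s hrs
    by_cases e1 : s.swap = j.swap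
    · have e1' : s = j := by simpa using congrArg Sum.swap e1
      have : r ≠ k := by rintro rfl; subst e1'; exact hrs hkj
      simp [bv, this]
    · simp [bv, e1]
  have hz2 : ∀ r s, ¬ (K.k r < K.k s) → (bv k : Pos m → F) s.swap * (bv j.swap : Pos m → F) r = 0 := by
    intro r s hrs
    by_cases e1 : s.swap = k
    · have : r ≠ j.swap := by
        rintro rfl
        apply hrs
        have : s = k.swap := by rw [← e1, Sum.swap_swap]
        rw [this]; exact K.lt_swap.2 hkj
      simp [bv, this]
    · simp [bv, e1]
  have huU : u ∈ Uni F K := by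
    refine ⟨fun r s hrs => ?_, fun r => ?_⟩
    · have : r ≠ s := by rintro rfl; omega
      rw [ent, one_apply_ne this]
      linear_combination sg F s * hz1 r s (by omega) + sg F s * hz2 r s (by omega)
    · rw [ent, one_apply_eq]
      linear_combination sg F r * hz1 r r (by omega) + sg F r * hz2 r r (by omega)
  set b := g⁻¹ * u * g with hb
  have hbB : b ∈ Bor F K := h u huU
  have hgb : g * b = u * g := by rw [hb]; group
  have hL : ∀ r, (∀ y, K.k y < K.k k → g.1 r y = 0) → (g * b).1 r k = g.1 r k * b.1 k k := by
    intro r hr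
    change (g.1 * b.1) r k = _
    rw [Matrix.mul_apply, Finset.sum_eq_single k]
    · intro y _ hy
      rcases lt_trichotomy (K.k y) (K.k k) with h1 | h1 | h1
      · rw [hr y h1, zero_mul]
      · exact absurd (K.inj h1) hy
      · rw [hbB y k h1, mul_zero]
    · simp
  have hR : ∀ r, (u * g).1 r k = g.1 r k + (sg F j * g.1 j k) * (bv k : Pos m → F) r
      - (sg F k * g.1 k.swap k) * (bv j.swap : Pos m → F) r := by
    intro r
    rw [entry (u * g).1 r k, Sp_mul_mulVec, hu, shrS_mulVec, om_bv_right, om_bv_right, Sum.swap_swap, sg_swap]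
    simp only [Pi.add_apply, Pi.smul_apply, smul_eq_mul, ← entry]
    ring
  have e1 := hL j hrow
  have e2 := hL k hrow'
  rw [hgb, hR] at e1 e2
  have z1 : (bv k : Pos m → F) j = 0 := by simp [bv, hjk]
  have z2 : (bv j.swap : Pos m → F) j = 0 := by simp [bv, hjs]
  have z3 : (bv k : Pos m → F) k = 1 := by simp [bv]
  rw [z1, z2] at e1
  rw [z3] at e2
  have hb1 : b.1 k k = 1 := by
    apply mul_left_cancel₀ hne
    linear_combination -e1
  rw [hb1] at e2
  have hsj := sg_ne (F := F) j
  by_cases hk : k = j.swap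
  · have z4 : (bv j.swap : Pos m → F) k = 1 := by simp [bv, hk]
    rw [z4, hk, Sum.swap_swap, sg_swap] at e2
    have e2' : 2 * (sg F j * g.1 j k) = 0 := by rw [hk]; linear_combination e2
    exact mul_ne_zero h2 (mul_ne_zero hsj hne) e2'
  · have z4 : (bv j.swap : Pos m → F) k = 0 := by simp [bv, hk]
    rw [z4] at e2
    exact mul_ne_zero hsj hne (by linear_combination e2)

theorem Uni_pow (K : Key m) (p : ℕ) [Fact p.Prime] [CharP F p] (u : Sp m F) (hu : u ∈ Uni F K) :
    ∃ k : ℕ, u ^ p ^ k = 1 := by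
  set n : Mt m F := u.1 - 1 with hn
  have hsupp : ∀ x z, ¬ ((fun x => - K.k x) z < (fun x => - K.k x) x) → n x z = 0 := by
    intro x z h
    rw [hn, Matrix.sub_apply]
    by_cases e : x = z
    · subst e; rw [hu.2, one_apply_eq, sub_self]
    · have : K.k x ≠ K.k z := fun e' => e (K.inj e')
      rw [hu.1 x z (by simp only at h; omega), one_apply_ne e, sub_self]
  obtain ⟨M, hM⟩ : ∃ M : ℕ, ∀ x z : Pos m, K.k x - K.k z < M := by
    refine ⟨1 + ∑ q : Pos m × Pos m, (K.k q.1 - K.k q.2).natAbs, fun x z => ?_⟩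
    have := Finset.single_le_sum (f := fun q : Pos m × Pos m => (K.k q.1 - K.k q.2).natAbs)
      (fun _ _ => Nat.zero_le _) (Finset.mem_univ (x, z))
    simp only at this
    omega
  refine ⟨M, ?_⟩
  have hMp : M ≤ p ^ M := (Nat.lt_pow_self (Fact.out : p.Prime).one_lt).le
  have hnil : n ^ p ^ M = 0 := by
    ext x z
    rw [pow_supp _ n hsupp (p ^ M) x z ?_]
    · rfl
    · have := hM z x
      have : (M : ℤ) ≤ ((p ^ M : ℕ) : ℤ) := by exact_mod_cast hMp
      omega
  apply Subtype.ext
  change u.1 ^ p ^ M = 1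
  have e : u.1 = 1 + n := by rw [hn]; abel
  rcases isEmpty_or_nonempty (Fin m) with he | he
  · exact Subsingleton.elim _ _
  rw [e, add_pow_char_pow_of_commute p _ (Commute.one_left n), hnil, one_pow, add_zero]

theorem Bor_p_elem (K : Key m) (p : ℕ) [Fact p.Prime] [CharP F p] (b : Sp m F) (hb : b ∈ Bor F K) (k : ℕ)
    (h : b ^ p ^ k = 1) : b ∈ Uni F K := by
  refine ⟨hb, fun x => ?_⟩
  have hpow : ∀ i : ℕ, (b ^ i).1 x x = (b.1 x x) ^ i := by
    intro i
    induction i with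
    | zero => rw [pow_zero, pow_zero]; change (1 : Mt m F) x x = 1; simp
    | succ i ih => rw [pow_succ, Bor_diag_mul ((Bor F K).pow_mem hb i) hb, ih, pow_succ]
  have h1 := hpow (p ^ k)
  rw [h] at h1
  have h3 : (b.1 x x) ^ p ^ k = 1 := by
    rw [← h1]; change (1 : Mt m F) x x = 1; simp
  have h4 : iterateFrobenius F p k (b.1 x x) = iterateFrobenius F p k 1 := by
    rw [iterateFrobenius_def, h3, map_one]
  exact (iterateFrobenius F p k).injective h4

theorem sylow_conj (h2 : (2:F) ≠ 0) (K : Key m) (p : ℕ) [hp : Fact p.Prime] [CharP F p]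
    (P : Subgroup (Sp m F)) (hP : IsPGroup p P) :
    ∃ g : Sp m F, ∀ x ∈ P, g⁻¹ * x * g ∈ Uni F K := by
  classical
  have hU : IsPGroup p (Uni F K) := by
    rintro ⟨u, hu⟩
    obtain ⟨k, hk⟩ := Uni_pow K p u hu
    exact ⟨k, Subtype.ext hk⟩
  have c1 := hU.card_modEq_card_fixedPoints (Sp m F ⧸ Bor F K)
  have c2 := hP.card_modEq_card_fixedPoints (Sp m F ⧸ Bor F K)
  have fix : ∀ (Q : Subgroup (Sp m F)) (g : Sp m F),
      (g : Sp m F ⧸ Bor F K) ∈ MulAction.fixedPoints Q (Sp m F ⧸ Bor F K) ↔ ∀ x ∈ Q, g⁻¹ * x * g ∈ Bor F K := by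
    intro Q g
    rw [MulAction.mem_fixedPoints]
    constructor
    · intro h x hx
      have := h ⟨x, hx⟩
      have h3 : ((x * g : Sp m F) : Sp m F ⧸ Bor F K) = g := this
      rw [eq_comm, QuotientGroup.eq] at h3
      rwa [mul_assoc]
    · rintro h ⟨x, hx⟩
      change ((x * g : Sp m F) : Sp m F ⧸ Bor F K) = g
      rw [eq_comm, QuotientGroup.eq, ← mul_assoc]
      exact h x hx
  have one : MulAction.fixedPoints (Uni F K) (Sp m F ⧸ Bor F K) = {((1 : Sp m F) : Sp m F ⧸ Bor F K)} := by
    ext q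
    obtain ⟨g, rfl⟩ := QuotientGroup.mk_surjective q
    rw [fix, Set.mem_singleton_iff]
    constructor
    · intro h
      have := fixed_unique h2 K g h
      rw [eq_comm, QuotientGroup.eq]; simpa using this
    · intro h
      rw [eq_comm, QuotientGroup.eq] at h
      have hg : g ∈ Bor F K := by simpa using h
      intro x hx
      exact (Bor F K).mul_mem ((Bor F K).mul_mem ((Bor F K).inv_mem hg) hx.1) hg
  have hone : Nat.card ({((1 : Sp m F) : Sp m F ⧸ Bor F K)} : Set (Sp m F ⧸ Bor F K)) = 1 := Nat.card_unique
  rw [one, hone] at c1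
  have c3 := c2.symm.trans c1
  have hne : (MulAction.fixedPoints P (Sp m F ⧸ Bor F K)).Nonempty := by
    rw [Set.nonempty_iff_ne_empty]
    intro h0
    rw [h0] at c3
    simp only [Nat.card_of_isEmpty] at c3
    have : p ∣ 1 := (Nat.modEq_zero_iff_dvd).1 c3.symm
    exact hp.out.one_lt.ne' (Nat.dvd_one.1 this)
  obtain ⟨q, hq⟩ := hne
  obtain ⟨g, rfl⟩ := QuotientGroup.mk_surjective q
  rw [fix] at hq
  refine ⟨g, fun x hx => ?_⟩
  obtain ⟨k, hk⟩ := hP ⟨x, hx⟩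
  have hk' : x ^ p ^ k = 1 := congrArg Subtype.val hk
  refine Bor_p_elem K p _ (hq x hx) k ?_
  have := conj_pow (i := p ^ k) (a := g⁻¹) (b := x)
  rw [inv_inv] at this
  rw [this, hk']; simp
end SpIdx

set_option linter.all false
set_option linter.unusedSectionVars false
set_option linter.unusedVariables false
namespace SpIdx
open Matrix

theorem sylow_abs {Γ T : Type} [Group Γ] [Finite Γ] [Group T] (p : ℕ) [Fact p.Prime]
    (P : Sylow p Γ) (N : Subgroup Γ) [N.Normal] (hN : Nat.Coprime N.index p)
    (E : Subgroup Γ) (hEN : E ≤ N) (hEM : E ≤ Subgroup.normalizer (P : Set Γ)) (f : E →* T)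
    (hPE : ∀ x ∈ P, x ∈ N → ∃ h : x ∈ E, f ⟨x, h⟩ = 1) (X : ℕ)
    (hX : ∀ K : Subgroup Γ, (Nat.card K).Coprime p → Nat.card K ≤ X) :
    N.index * Nat.card f.range ≤ X := by
  have hPN : (P : Subgroup Γ) ≤ N := by
    intro x hx
    obtain ⟨k, hk⟩ := P.isPGroup' ⟨x, hx⟩
    have hk : x ^ p ^ k = 1 := congrArg Subtype.val hk
    have h1 : ((x : Γ ⧸ N)) ^ p ^ k = 1 := by
      rw [← QuotientGroup.mk_pow, hk]; rfl
    have h2 : ((x : Γ ⧸ N)) ^ N.index = 1 := by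
      rw [Subgroup.index]; exact pow_card_eq_one'
    have h3 := orderOf_dvd_of_pow_eq_one h1
    have h4 := orderOf_dvd_of_pow_eq_one h2
    have h5 : orderOf (x : Γ ⧸ N) = 1 :=
      Nat.eq_one_of_dvd_coprimes (Nat.Coprime.pow_right k hN) h4 h3
    exact (QuotientGroup.eq_one_iff x).1 (orderOf_eq_one_iff.1 h5)
  set M := Subgroup.normalizer (P : Set Γ) with hM
  have hPM : (P : Subgroup Γ) ≤ M := Subgroup.le_normalizer
  have e1 : N.index = N.relIndex M := by
    have := Subgroup.relIndex_sup_right M N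
    rw [hM, Sylow.normalizer_sup_eq_top' P hPN, Subgroup.relIndex_top_right] at this
    exact this
  have e2 : Nat.card (N.subgroupOf M) * N.relIndex M = Nat.card M :=
    Subgroup.card_mul_index _
  have e3 : Nat.card E ≤ Nat.card (N.subgroupOf M) := by
    refine Nat.card_le_card_of_injective
      (fun x : E => (⟨⟨x.1, hEM x.2⟩, hEN x.2⟩ : N.subgroupOf M)) ?_
    intro x y h
    exact Subtype.ext (congrArg (fun z => z.1.1) h)
  have e4 : Nat.card f.ker * Nat.card f.range = Nat.card E := by
    rw [← Subgroup.index_ker]; exact Subgroup.card_mul_index _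
  have e5 : Nat.card P ≤ Nat.card f.ker := by
    refine Nat.card_le_card_of_injective
      (fun x : P => (⟨⟨x.1, (hPE x.1 x.2 (hPN x.2)).1⟩, (hPE x.1 x.2 (hPN x.2)).2⟩ : f.ker)) ?_
    intro x y h
    exact Subtype.ext (congrArg (fun z => z.1.1) h)
  have hcop : (Nat.card ((P : Subgroup Γ).subgroupOf M)).Coprime ((P : Subgroup Γ).subgroupOf M).index := by
    have a := Sylow.card_coprime_index P
    rw [← Subgroup.relIndex_mul_index hPM] at a
    have b : Nat.card ((P : Subgroup Γ).subgroupOf M) = Nat.card P :=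
      Nat.card_congr (Subgroup.subgroupOfEquivOfLe hPM).toEquiv
    rw [b]
    exact a.coprime_mul_right_right
  have hnorm : ((P : Subgroup Γ).subgroupOf M).Normal := Subgroup.normal_in_normalizer
  obtain ⟨K, hK⟩ := Subgroup.exists_right_complement'_of_coprime hcop
  have e6 := hK.card_mul
  have e7 : Nat.card ((P : Subgroup Γ).subgroupOf M) = Nat.card P :=
      Nat.card_congr (Subgroup.subgroupOfEquivOfLe hPM).toEquiv
  have e8 : Nat.card (K.map M.subtype) = Nat.card K :=
    (Nat.card_congr (K.equivMapOfInjective M.subtype M.subtype_injective).toEquiv).symm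
  have e9 : Nat.card K = ((P : Subgroup Γ).subgroupOf M).index := hK.symm.index_eq_card.symm
  have e10 : (Nat.card K).Coprime p := by
    have : ¬ p ∣ (P : Subgroup Γ).index := P.not_dvd_index
    rw [← Subgroup.relIndex_mul_index hPM] at this
    rw [e9, Nat.coprime_comm, (Fact.out : p.Prime).coprime_iff_not_dvd]
    exact fun h => this (h.mul_right _)
  have e11 := hX (K.map M.subtype) (by rwa [e8])
  rw [e8] at e11
  rw [e7] at e6
  have hP0 : 0 < Nat.card P := Nat.card_pos
  have : Nat.card P * (N.index * Nat.card f.range) ≤ Nat.card P * Nat.card K := by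
    calc Nat.card P * (N.index * Nat.card f.range) = (Nat.card P * Nat.card f.range) * N.index := by ring
      _ ≤ (Nat.card f.ker * Nat.card f.range) * N.index := by gcongr
      _ = Nat.card E * N.index := by rw [e4]
      _ ≤ Nat.card (N.subgroupOf M) * N.index := by gcongr
      _ = Nat.card P * Nat.card K := by rw [e1, e2, e6]
  exact (Nat.le_of_mul_le_mul_left this hP0).trans e11

variable {m : ℕ} {F : Type} [Field F] [Fintype F]

theorem norm_bound (p : ℕ) [Fact p.Prime] [CharP F p] (H : Subgroup (Sp m F)) (N : Subgroup H)
    (hNn : N.Normal) (hN : Nat.Coprime N.index p) (P : Sylow p H)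
    (hP : ∀ x ∈ P, x.1 ∈ Uni F (posK m)) (X : ℕ)
    (hX : ∀ K : Subgroup (Sp m F), (Nat.card K).Coprime p → Nat.card K ≤ X) :
    N.index * (Nat.card (((N.map H.subtype).subgroupOf (Bor F (posK m))).map (dg (posK m)))) ≤ X := by
  set K := posK m with hK
  let E : Subgroup H := N ⊓ (Bor F K).subgroupOf H
  have hE : ∀ x : E, x.1.1 ∈ Bor F K := fun x => x.2.2
  let j : E →* Bor F K :=
    { toFun := fun x => ⟨x.1.1, hE x⟩
      map_one' := rfl
      map_mul' := fun x y => rfl }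
  let f := (dg K).comp j
  have hUP : ∀ x : H, x.1 ∈ Uni F K → x ∈ P := by
    let Q : Subgroup H := (Uni F K).subgroupOf H
    have hQ : IsPGroup p Q := by
      intro x
      obtain ⟨k, hk⟩ := Uni_pow K p x.1.1 x.2
      exact ⟨k, Subtype.ext (Subtype.ext hk)⟩
    have : Q = P := P.is_maximal' hQ (fun x hx => hP x hx)
    intro x hx
    have : x ∈ Q := hx
    rw [‹Q = P›] at this
    exact this
  have hBU : ∀ b ∈ Bor F K, ∀ u ∈ Uni F K, b * u * b⁻¹ ∈ Uni F K := by
    intro b hb u hu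
    obtain ⟨k, hk⟩ := Uni_pow K p u hu
    refine Bor_p_elem K p _ ((Bor F K).mul_mem ((Bor F K).mul_mem hb hu.1) ((Bor F K).inv_mem hb)) k ?_
    rw [conj_pow, hk, mul_one, mul_inv_cancel]
  have key := sylow_abs p P N hN E inf_le_left ?_ f ?_ X ?_
  · refine le_trans (Nat.mul_le_mul_left _ ?_) key
    apply Nat.card_mono (Set.toFinite _)
    rintro _ ⟨b, hb, rfl⟩
    obtain ⟨n, hn, hnb⟩ := hb
    have hnb : n.1 = b.1 := hnb
    refine ⟨⟨n, hn, ?_⟩, ?_⟩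
    · change n.1 ∈ Bor F K
      rw [hnb]; exact b.2
    · change dg K _ = dg K b
      congr 1
      exact Subtype.ext hnb
  · intro b hb
    have hb' : b.1 ∈ Bor F K := hb.2
    refine (Subgroup.mem_normalizer_iff (H := (P : Subgroup H))).2 ?_
    intro x
    constructor
    · intro hx
      exact hUP _ (hBU _ hb' _ (hP x hx))
    · intro hx
      apply hUP
      have := hBU _ ((Bor F K).inv_mem hb') _ (hP _ hx)
      have e : b.1⁻¹ * (b * x * b⁻¹ : H).1 * b.1⁻¹⁻¹ = x.1 := by
        change b.1⁻¹ * (b.1 * x.1 * b.1⁻¹) * b.1⁻¹⁻¹ = x.1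
        group
      rwa [e] at this
  · intro x hx hxN
    have hu := hP x hx
    refine ⟨⟨hxN, hu.1⟩, ?_⟩
    funext i
    exact Units.ext (hu.2 _)
  · intro L hL
    have e8 : Nat.card (L.map H.subtype) = Nat.card L :=
      (Nat.card_congr (L.equivMapOfInjective H.subtype H.subtype_injective).toEquiv).symm
    rw [← e8]
    exact hX _ (by rwa [e8])

theorem main_special (h2 : (2:F) ≠ 0) (p : ℕ) [Fact p.Prime] [CharP F p] (H : Subgroup (Sp m F)) (N : Subgroup H)
    (hNn : N.Normal) (hab : ∀ a b : H, a*b*a⁻¹*b⁻¹ ∈ N) (hN : Nat.Coprime N.index p) (P : Sylow p H)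
    (hP : ∀ x ∈ P, x.1 ∈ Uni F (posK m)) (C : ℕ)
    (hX : ∀ K : Subgroup (Sp m F), (Nat.card K).Coprime p → Nat.card K ≤ C * (Fintype.card F)^m) :
    N.index ^ m ≤ ((C * 2^m)^m * (2*m+2)^(m*m)) * H.index := by
  have h1 := norm_bound p H N hNn hN P hP _ hX
  have h3 := dual_bound h2 H N hNn hab
  set s := Nat.card (((N.map H.subtype).subgroupOf (Bor F (posK m))).map (dg (posK m))) with hs
  have hs0 : 0 < s := Nat.card_pos
  have hq : 2 ≤ Fintype.card F := Fintype.one_lt_card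
  have hq2 : Fintype.card F ≤ 2 * (Fintype.card F - 1) := by omega
  have h4 : N.index * s ≤ (C * 2^m) * (Fintype.card F - 1)^m := by
    calc _ ≤ C * (Fintype.card F)^m := h1
      _ ≤ C * (2 * (Fintype.card F - 1))^m := by gcongr
      _ = _ := by rw [mul_pow]; ring
  have h5 : s^m * N.index^m ≤ s^m * (((C * 2^m)^m * (2*m+2)^(m*m)) * H.index) := by
    calc s^m * N.index^m = (N.index * s)^m := by rw [mul_pow, mul_comm]
      _ ≤ ((C * 2^m) * (Fintype.card F - 1)^m)^m := by gcongr
      _ = (C * 2^m)^m * ((Fintype.card F - 1)^m)^m := by rw [mul_pow]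
      _ ≤ (C * 2^m)^m * (s^m * ((2*m+2)^(m*m) * H.index)) := by gcongr
      _ = _ := by ring
  exact Nat.le_of_mul_le_mul_left h5 (by positivity)

theorem main_general (h2 : (2:F) ≠ 0) (p : ℕ) [Fact p.Prime] [CharP F p] (H : Subgroup (Sp m F)) (N : Subgroup H)
    (hNn : N.Normal) (hab : ∀ a b : H, a*b*a⁻¹*b⁻¹ ∈ N) (hN : Nat.Coprime N.index p) (C : ℕ)
    (hX : ∀ K : Subgroup (Sp m F), (Nat.card K).Coprime p → Nat.card K ≤ C * (Fintype.card F)^m) :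
    N.index ^ m ≤ ((C * 2^m)^m * (2*m+2)^(m*m)) * H.index := by
  let P : Sylow p H := default
  obtain ⟨g, hg⟩ := sylow_conj h2 (posK m) p ((P : Subgroup H).map H.subtype)
    (P.isPGroup'.map H.subtype)
  let c : Sp m F ≃* Sp m F := MulAut.conj g⁻¹
  have hc : ∀ x, c x = g⁻¹ * x * g := fun x => by simp [c]
  let e := H.equivMapOfInjective c.toMonoidHom c.injective
  have he : ∀ x, (e x).1 = c x.1 := fun x => rfl
  have hes : Function.Surjective e.toMonoidHom := e.surjective
  let P' := P.mapSurjective hes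
  have hidx : (N.map e.toMonoidHom).index = N.index := Subgroup.index_map_equiv N e
  have hidx2 : (H.map c.toMonoidHom).index = H.index := Subgroup.index_map_equiv H c
  have := main_special h2 p (H.map c.toMonoidHom) (N.map e.toMonoidHom) (hNn.map _ hes) ?_ (by rwa [hidx]) P' ?_ C hX
  · rwa [hidx, hidx2] at this
  · intro a b
    obtain ⟨a, rfl⟩ := hes a
    obtain ⟨b, rfl⟩ := hes b
    exact ⟨_, hab a b, by rw [map_mul, map_mul, map_mul, map_inv, map_inv]⟩
  · intro x hx
    have hx : x ∈ (P : Subgroup H).map e.toMonoidHom := hx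
    obtain ⟨y, hy, rfl⟩ := hx
    change c y.1 ∈ _
    rw [hc]
    exact hg _ ⟨y, hy, rfl⟩
end SpIdx

set_option linter.all false
set_option linter.unusedSectionVars false
set_option linter.unusedVariables false
namespace SpIdx
open Matrix
variable {m : ℕ} {F : Type} [Field F] [Fintype F]

theorem tv_orth (h2 : (2:F) ≠ 0) (c : F) (a : Pos m → F) : om a ((c/2) • a) = 0 := by
  rw [om_smul_right, om_self h2, mul_zero]

/-- transvections -/
def tv (h2 : (2:F) ≠ 0) (c : F) (a : Pos m → F) : Sp m F := shrS h2 a ((c/2) • a) (tv_orth h2 c a)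

theorem tv_mulVec (h2 : (2:F) ≠ 0) (c : F) (a y : Pos m → F) :
    (tv h2 c a).1 *ᵥ y = y + (c * om y a) • a := by
  unfold tv
  rw [shrS_mulVec, om_smul_right, smul_smul, add_assoc, ← add_smul]
  congr 2
  field_simp
  ring

theorem tv_add (h2 : (2:F) ≠ 0) (c d : F) (a : Pos m → F) : tv h2 (c + d) a = tv h2 c a * tv h2 d a := by
  apply Sp_ext; intro y
  rw [Sp_mul_mulVec, tv_mulVec, tv_mulVec, tv_mulVec, om_add_left, om_smul_left, om_self h2]
  module

theorem tv_zero (h2 : (2:F) ≠ 0) (a : Pos m → F) : tv h2 0 a = 1 := by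
  apply Sp_ext; intro y
  change _ = (1 : Mt m F) *ᵥ y
  rw [tv_mulVec, one_mulVec]; module

theorem tv_neg (h2 : (2:F) ≠ 0) (c : F) (a : Pos m → F) : tv h2 (-c) a = (tv h2 c a)⁻¹ := by
  apply eq_inv_of_mul_eq_one_left
  rw [← tv_add, neg_add_cancel, tv_zero]

theorem tv_conj (h2 : (2:F) ≠ 0) (c l : F) (a : Pos m → F) (g : Sp m F) (hg : g.1 *ᵥ a = l • a) :
    g * tv h2 c a * g⁻¹ = tv h2 (l * l * c) a := by
  rw [mul_inv_eq_iff_eq_mul]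
  apply Sp_ext; intro y
  rw [Sp_mul_mulVec, Sp_mul_mulVec, tv_mulVec, tv_mulVec, mulVec_add, mulVec_smul, hg]
  have h := om_Sp g y a
  rw [hg, om_smul_right] at h
  rw [← h]
  module

theorem exists_pair (a : Pos m → F) (ha : a ≠ 0) : ∃ u, om a u = 1 := by
  by_contra h
  push Not at h
  apply ha
  apply om_ext
  intro y
  rw [om_zero_right, om_swap, neg_eq_zero]
  by_contra h1
  exact h ((om a y)⁻¹ • y) (by rw [om_smul_right, inv_mul_cancel₀ h1])

theorem all_tv (h2 : (2:F) ≠ 0) (K : Subgroup (Sp m F)) (hK : K.Normal) (hi : K.index < Fintype.card F)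
    (a : Pos m → F) (c : F) : tv h2 c a ∈ K := by
  by_cases ha : a = 0
  · have : tv h2 c a = tv h2 0 a := by
      apply Sp_ext; intro y
      rw [tv_mulVec, tv_mulVec, ha]; simp
    rw [this, tv_zero]; exact K.one_mem
  obtain ⟨u, hu⟩ := exists_pair a ha
  obtain ⟨c0, hc0, h0⟩ : ∃ c0 : F, c0 ≠ 0 ∧ tv h2 c0 a ∈ K := by
    by_contra hno
    push Not at hno
    have : Function.Injective (fun c : F => (tv h2 c a : Sp m F ⧸ K)) := by
      intro x y hxy
      have hxy := QuotientGroup.eq.1 hxy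
      rw [← tv_neg, ← tv_add] at hxy
      by_contra hne
      exact hno (-x + y) (fun h => hne (by linear_combination -h)) hxy
    have := Nat.card_le_card_of_injective _ this
    rw [Nat.card_eq_fintype_card] at this
    exact absurd (lt_of_le_of_lt this hi) (lt_irrefl _)
  have hsq : ∀ l : F, tv h2 (l * l * c0) a ∈ K := by
    intro l
    by_cases hl : l = 0
    · rw [hl, zero_mul, zero_mul, tv_zero]; exact K.one_mem
    · rw [← tv_conj h2 c0 l a (dilS h2 a u hu l hl)]
      · exact hK.conj_mem _ h0 _
      · rw [dilS_mulVec, hu, om_self h2]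
        module
  have e : c = ((c/c0+1)/2) * ((c/c0+1)/2) * c0 + -(((c/c0-1)/2) * ((c/c0-1)/2) * c0) := by
    field_simp
    ring
  rw [e, tv_add, tv_neg]
  exact K.mul_mem (hsq _) (K.inv_mem (hsq _))

theorem move (h2 : (2:F) ≠ 0) (Γ : Subgroup (Sp m F)) (hΓ : ∀ a c, tv h2 c a ∈ Γ)
    (v w : Pos m → F) (h : om v w ≠ 0) :
    ∃ γ ∈ Γ, γ.1 *ᵥ v = w ∧ ∀ s, om s v = om s w → γ.1 *ᵥ s = s := by
  refine ⟨tv h2 (om v w)⁻¹ (w - v), hΓ _ _, ?_, ?_⟩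
  · rw [tv_mulVec, om_sub_right, om_self h2, sub_zero, inv_mul_cancel₀ h]; module
  · intro s hs
    rw [tv_mulVec, om_sub_right, hs, sub_self]; module

theorem move2 (h2 : (2:F) ≠ 0) (Γ : Subgroup (Sp m F)) (hΓ : ∀ a c, tv h2 c a ∈ Γ)
    (v z w : Pos m → F) (h : om v z ≠ 0) (h' : om z w ≠ 0) :
    ∃ γ ∈ Γ, γ.1 *ᵥ v = w ∧ ∀ s, om s v = om s z → om s z = om s w → γ.1 *ᵥ s = s := by
  obtain ⟨γ, h1, h3, h4⟩ := move h2 Γ hΓ v z h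
  obtain ⟨γ', h1', h3', h4'⟩ := move h2 Γ hΓ z w h'
  refine ⟨γ' * γ, Γ.mul_mem h1' h1, ?_, ?_⟩
  · rw [Sp_mul_mulVec, h3, h3']
  · intro s hs hs'
    rw [Sp_mul_mulVec, h4 s hs, h4' s hs']

theorem gen_step (h2 : (2:F) ≠ 0) (Γ : Subgroup (Sp m F)) (hΓ : ∀ a c, tv h2 c a ∈ Γ) (g : Sp m F)
    (e f : Pos m → F) (hef : om e f = 1) (S : Set (Pos m → F)) (hS : ∀ s ∈ S, om s e = 0 ∧ om s f = 0)
    (hg : ∀ s ∈ S, g.1 *ᵥ s = s) :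
    ∃ γ ∈ Γ, (γ * g).1 *ᵥ e = e ∧ (γ * g).1 *ᵥ f = f ∧ ∀ s ∈ S, (γ * g).1 *ᵥ s = s := by
  have hfe : om f e = -1 := by rw [om_swap, hef]
  have hv : ∀ s ∈ S, ∀ x, om s (g.1 *ᵥ x) = om s x := by
    intro s hs x
    conv_lhs => rw [← hg s hs]
    exact om_Sp g s x
  obtain ⟨γ1, k1, k2, k3⟩ : ∃ γ ∈ Γ, γ.1 *ᵥ (g.1 *ᵥ e) = e ∧ ∀ s ∈ S, γ.1 *ᵥ s = s := by
    have hvf : om (g.1 *ᵥ e) (g.1 *ᵥ f) = 1 := by rw [om_Sp, hef]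
    obtain ⟨z, z1, z2, z3⟩ : ∃ z, om (g.1 *ᵥ e) z ≠ 0 ∧ om z e ≠ 0 ∧ ∀ s ∈ S, om s z = 0 := by
      by_cases c1 : om (g.1 *ᵥ e) f = 0
      · by_cases c2 : om (g.1 *ᵥ f) e = 0
        · refine ⟨f + g.1 *ᵥ f, ?_, ?_, ?_⟩
          · rw [om_add_right, c1, hvf]; simp
          · rw [om_add_left, c2, hfe]; simp
          · intro s hs
            rw [om_add_right, hv s hs, (hS s hs).2, add_zero]
        · exact ⟨g.1 *ᵥ f, by rw [hvf]; simp, c2, fun s hs => by rw [hv s hs, (hS s hs).2]⟩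
      · exact ⟨f, c1, by rw [hfe]; simp, fun s hs => (hS s hs).2⟩
    obtain ⟨γ, h1, h3, h4⟩ := move2 h2 Γ hΓ _ z e z1 z2
    refine ⟨γ, h1, h3, fun s hs => h4 s ?_ ?_⟩
    · rw [hv s hs, z3 s hs, (hS s hs).1]
    · rw [z3 s hs, (hS s hs).1]
  have k2' : (γ1 * g).1 *ᵥ e = e := by rw [Sp_mul_mulVec, k2]
  have k3' : ∀ s ∈ S, (γ1 * g).1 *ᵥ s = s := fun s hs => by rw [Sp_mul_mulVec, hg s hs, k3 s hs]
  set w := (γ1 * g).1 *ᵥ f with hw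
  have hew : om e w = 1 := by
    rw [← hef]
    conv_lhs => rw [← k2']
    exact om_Sp _ _ _
  have hsw : ∀ s ∈ S, om s w = 0 := by
    intro s hs
    rw [← (hS s hs).2]
    conv_lhs => rw [← k3' s hs]
    exact om_Sp _ _ _
  obtain ⟨γ2, l1, l2, l3, l4⟩ : ∃ γ ∈ Γ, γ.1 *ᵥ w = f ∧ γ.1 *ᵥ e = e ∧ ∀ s ∈ S, γ.1 *ᵥ s = s := by
    by_cases c1 : om w f = 0
    · obtain ⟨γ, h1, h3, h4⟩ := move2 h2 Γ hΓ w (e + w) f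
        (by rw [om_add_right, om_self h2, om_swap, hew]; simp)
        (by rw [om_add_left, hef, c1]; simp)
      refine ⟨γ, h1, h3, h4 e ?_ ?_, fun s hs => h4 s ?_ ?_⟩
      · rw [om_add_right, om_self h2, zero_add]
      · rw [om_add_right, om_self h2, zero_add, hew, hef]
      · rw [om_add_right, hsw s hs, (hS s hs).1, zero_add]
      · rw [om_add_right, hsw s hs, (hS s hs).1, (hS s hs).2, zero_add]
    · obtain ⟨γ, h1, h3, h4⟩ := move h2 Γ hΓ w f c1
      refine ⟨γ, h1, h3, h4 e ?_, fun s hs => h4 s ?_⟩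
      · rw [hew, hef]
      · rw [hsw s hs, (hS s hs).2]
  refine ⟨γ2 * γ1, Γ.mul_mem l1 k1, ?_, ?_, ?_⟩
  · rw [mul_assoc, Sp_mul_mulVec, k2', l3]
  · rw [mul_assoc, Sp_mul_mulVec, ← hw, l2]
  · intro s hs
    rw [mul_assoc, Sp_mul_mulVec, k3' s hs, l4 s hs]

theorem gen (h2 : (2:F) ≠ 0) (Γ : Subgroup (Sp m F)) (hΓ : ∀ a c, tv h2 c a ∈ Γ) : Γ = ⊤ := by
  rw [eq_top_iff]
  rintro g -
  have key : ∀ k ≤ m, ∃ γ ∈ Γ, ∀ i : Fin m, i.val < k →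
      (γ * g).1 *ᵥ bv (Sum.inl i) = bv (Sum.inl i) ∧ (γ * g).1 *ᵥ bv (Sum.inr i) = bv (Sum.inr i) := by
    intro k
    induction k with
    | zero => exact fun _ => ⟨1, Γ.one_mem, fun i hi => absurd hi (by omega)⟩
    | succ k ih =>
      intro hk
      obtain ⟨γ, h1, h3⟩ := ih (by omega)
      let j : Fin m := ⟨k, by omega⟩
      let S : Set (Pos m → F) := {s | ∃ i : Fin m, i.val < k ∧ (s = bv (Sum.inl i) ∨ s = bv (Sum.inr i))}
      have q1 : ∀ s ∈ S, om s (bv (Sum.inl j)) = 0 ∧ om s (bv (Sum.inr j)) = 0 := by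
        rintro s ⟨i, hi, rfl | rfl⟩
        · have : j ≠ i := fun h => by rw [← h] at hi; exact lt_irrefl _ hi
          rw [om_bv_left, om_bv_left]; simp [bv, this, this.symm]
        · have : j ≠ i := fun h => by rw [← h] at hi; exact lt_irrefl _ hi
          rw [om_bv_left, om_bv_left]; simp [bv, this, this.symm]
      have q2 : ∀ s ∈ S, (γ * g).1 *ᵥ s = s := by
        rintro s ⟨i, hi, rfl | rfl⟩
        · exact (h3 i hi).1
        · exact (h3 i hi).2
      obtain ⟨γ', h1', h4, h5, h6⟩ := gen_step h2 Γ hΓ (γ * g) (bv (Sum.inl j)) (bv (Sum.inr j))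
        (by rw [om_bv_left]; simp [sg, bv]) S q1 q2
      refine ⟨γ' * γ, Γ.mul_mem h1' h1, ?_⟩
      intro i hi
      rw [mul_assoc]
      by_cases hik : i.val < k
      · exact ⟨h6 _ ⟨i, hik, Or.inl rfl⟩, h6 _ ⟨i, hik, Or.inr rfl⟩⟩
      · have : i = j := Fin.ext (by change i.val = k; omega)
        rw [this]; exact ⟨h4, h5⟩
  obtain ⟨γ, h1, h3⟩ := key m le_rfl
  have : γ * g = 1 := by
    ext1
    apply Matrix.ext_of_mulVec_single
    intro z
    change _ = (1 : Mt m F) *ᵥ _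
    rw [one_mulVec]
    rcases z with i | i
    · exact (h3 i i.2).1
    · exact (h3 i i.2).2
  rw [eq_inv_of_mul_eq_one_right this]
  exact Γ.inv_mem h1

theorem small (h2 : (2:F) ≠ 0) (N : Subgroup (Sp m F)) (h : N.index.factorial < Fintype.card F) : N = ⊤ := by
  have : N.normalCore = ⊤ := by
    apply gen h2
    intro a c
    refine all_tv h2 _ inferInstance (lt_of_le_of_lt ?_ h) a c
    rw [Subgroup.normalCore_eq_ker, Subgroup.index_ker]
    have := Nat.card_le_card_of_injective
      (Subtype.val : (MulAction.toPermHom (Sp m F) (Sp m F ⧸ N)).range → _) Subtype.val_injective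
    rwa [Nat.card_perm] at this
  exact top_le_iff.1 (this ▸ N.normalCore_le)

theorem main_nat (m : ℕ) : ∃ C : ℕ, 1 ≤ C ∧ ∀ (F : Type) [Field F] [Fintype F], 3 < ringChar F →
    ∀ (H : Subgroup (Sp m F)) (N : Subgroup H), N.Normal → (∀ a b : H, a * b * a⁻¹ * b⁻¹ ∈ N) →
      Nat.Coprime N.index (ringChar F) → 1 < N.index →
      N.index ^ m ≤ C * H.index ∧ Fintype.card F ≤ (N.index * H.index).factorial := by
  obtain ⟨C, hC⟩ := coprime_bound m
  refine ⟨(C * 2^m)^m * (2*m+2)^(m*m) + 1, by omega, ?_⟩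
  intro F _ _ hp H N hN hab hco h1
  have hpr : Fact (ringChar F).Prime := ⟨CharP.char_is_prime F _⟩
  have h2 : (2:F) ≠ 0 := by
    intro h
    have h := (ringChar.spec F 2).1 (by exact_mod_cast h)
    have := Nat.le_of_dvd (by norm_num) h
    omega
  constructor
  · refine (main_general h2 (ringChar F) H N hN hab hco C (hC F hp)).trans ?_
    gcongr; omega
  · by_contra hlt
    push Not at hlt
    have e : (N.map H.subtype).index = N.index * H.index := by
      rw [Subgroup.index_map_subtype]
    have := small h2 (N.map H.subtype) (by rwa [e])
    rw [this, Subgroup.index_top] at e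
    have := Nat.eq_one_of_mul_eq_one_right e.symm
    omega
end SpIdx

theorem index_bound_Sp (m : ℕ) (hm : 1 ≤ m) :
    ∀ ε > (0 : ℝ), ∃ Q : ℕ, ∀ (F : Type) [Field F] [Fintype F], Q < Fintype.card F →
      3 < ringChar F →
      ∀ (H : Subgroup (Matrix.symplecticGroup (Fin m) F)) (N : Subgroup H),
        N.Normal →
        (∀ a b : H, a * b * a⁻¹ * b⁻¹ ∈ N) →  -- the quotient `H/N` is abelian
        Nat.Coprime N.index (ringChar F) →    -- `|H/N| = N.index` is coprime to `p`
        1 < N.index →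
        ((m : ℝ) - ε) * Real.log N.index ≤ Real.log H.index := by
  intro ε hε
  obtain ⟨C, hC1, hC⟩ := SpIdx.main_nat m
  obtain ⟨A, hA⟩ := exists_nat_gt (Real.exp (Real.log C / ε))
  refine ⟨(A ^ (m + 1)).factorial, ?_⟩
  intro F _ _ hQ hp H N hN hab hco h1
  obtain ⟨b1, b2⟩ := hC F hp H N hN hab hco h1
  have hn0 : 0 < Real.log (N.index : ℝ) := Real.log_pos (by exact_mod_cast h1)
  have hHpos : 0 < H.index := Nat.pos_of_ne_zero (by
    have : Finite (Matrix.symplecticGroup (Fin m) F) := inferInstance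
    exact Subgroup.index_ne_zero_of_finite)
  by_cases hNA : A ≤ N.index
  · have h3 : ((N.index : ℝ)) ^ m ≤ C * H.index := by exact_mod_cast b1
    have h4 := Real.log_le_log (by positivity) h3
    rw [Real.log_pow, Real.log_mul (by positivity) (by positivity)] at h4
    have h5 : Real.log C / ε ≤ Real.log N.index := by
      rw [Real.le_log_iff_exp_le (by positivity)]
      exact hA.le.trans (by exact_mod_cast hNA)
    rw [div_le_iff₀ hε] at h5
    linarith
  · push Not at hNA
    have h6 : A ^ (m + 1) < N.index * H.index :=
      lt_of_not_ge fun h => absurd (lt_of_lt_of_le hQ b2) (not_lt.2 (Nat.factorial_le h))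
    have h7 : N.index ^ m ≤ H.index := by
      have h8 : A * N.index ^ m ≤ A * H.index := by
        calc A * N.index ^ m ≤ A * A ^ m := by gcongr
          _ = A ^ (m + 1) := by ring
          _ ≤ N.index * H.index := h6.le
          _ ≤ A * H.index := by gcongr
      exact Nat.le_of_mul_le_mul_left h8 (by omega)
    have h9 : ((N.index : ℝ)) ^ m ≤ H.index := by exact_mod_cast h7
    have h4 := Real.log_le_log (by positivity) h9
    rw [Real.log_pow] at h4
    nlinarith
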